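/- Let G < GL(V) be a finite abelian p-group acting linearly over a field k of characteristic p > 0. Then the image of the transfer map Tr^G : k[V] → k[V]^G, Tr^G(f) = Σ_{σ∈G} σ(f), is a principal ideal of k[V]^G if and only if k[V]^G is a polynomial ring. -/

import Mathlib

open MvPolynomial

set_option synthInstance.maxHeartbeats 1000000
set_option maxHeartbeats 1000000

variable {k : Type*} [Field k] {ι : Type*} [Fintype ι] [DecidableEq ι]

noncomputable def galAct (M : Matrix.GeneralLinearGroup ι k) :
    MvPolynomial ι k →ₐ[k] MvPolynomial ι k :=
  aeval fun i => ∑ j, (((M⁻¹ : Matrix.GeneralLinearGroup ι k) : Matrix ι ι k) i j) • X j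

def invariants (G : Subgroup (Matrix.GeneralLinearGroup ι k)) :
    Subalgebra k (MvPolynomial ι k) where
  carrier := {p | ∀ σ ∈ G, galAct σ p = p}
  mul_mem' := fun ha hb σ hσ => by rw [map_mul, ha σ hσ, hb σ hσ]
  add_mem' := fun ha hb σ hσ => by rw [map_add, ha σ hσ, hb σ hσ]
  algebraMap_mem' := fun r σ hσ => by simp [galAct]

noncomputable def fixedSpace (M : Matrix.GeneralLinearGroup ι k) : Submodule k (ι → k) :=
  LinearMap.ker (Matrix.mulVecLin ((M : Matrix ι ι k) - 1))

noncomputable def moveSpace (M : Matrix.GeneralLinearGroup ι k) : Submodule k (ι → k) :=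
  LinearMap.range (Matrix.mulVecLin ((M : Matrix ι ι k) - 1))

def IsPseudoReflection (M : Matrix.GeneralLinearGroup ι k) : Prop :=
  Module.finrank k (moveSpace M) = 1

def IsTransvection (M : Matrix.GeneralLinearGroup ι k) : Prop :=
  IsPseudoReflection M ∧ moveSpace M ≤ fixedSpace M

noncomputable def linForm (y : Module.Dual k (ι → k)) : MvPolynomial ι k :=
  ∑ i, C (y (Pi.single i 1)) * X i

noncomputable def hilbertIdeal (G : Subgroup (Matrix.GeneralLinearGroup ι k)) :
    Ideal (MvPolynomial ι k) :=
  Ideal.span {p | p ∈ invariants G ∧ ∃ d, 0 < d ∧ p.IsHomogeneous d}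

def DSP (G : Subgroup (Matrix.GeneralLinearGroup ι k)) : Prop :=
  ∃ π : MvPolynomial ι k →ₗ[↥(invariants G)] ↥(invariants G),
    Function.Surjective π ∧
    ∀ (p : MvPolynomial ι k) (d : ℕ), p.IsHomogeneous d →
      ((π p : MvPolynomial ι k)).IsHomogeneous d

noncomputable def fixedSubmodule (G : Subgroup (Matrix.GeneralLinearGroup ι k)) :
    Submodule k (ι → k) := ⨅ σ ∈ G, fixedSpace σ

/-- The transfer map `Tr^G(f) = Σ_{σ ∈ G} σ(f)`. -/
noncomputable def transfer {k : Type*} [Field k] {ι : Type*} [Fintype ι] [DecidableEq ι]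
    (G : Subgroup (Matrix.GeneralLinearGroup ι k)) [Fintype ↥G]
    (f : MvPolynomial ι k) : MvPolynomial ι k :=
  ∑ σ : ↥G, galAct (σ : Matrix.GeneralLinearGroup ι k) f

/-- The image of the transfer map, as an ideal of the invariant ring `k[V]^G`. -/
noncomputable def transferImage {k : Type*} [Field k] {ι : Type*} [Fintype ι] [DecidableEq ι]
    (G : Subgroup (Matrix.GeneralLinearGroup ι k)) [Fintype ↥G] :
    Ideal ↥(invariants G) where
  carrier := {x | ∃ f : MvPolynomial ι k, transfer G f = ↑x}
  add_mem' := by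
    rintro a b ⟨f, hf⟩ ⟨g, hg⟩
    exact ⟨f + g, by simp only [transfer, map_add, Finset.sum_add_distrib] at *; rw [hf, hg]; rfl⟩
  zero_mem' := ⟨0, by simp [transfer]⟩
  smul_mem' := by
    rintro c x ⟨f, hf⟩
    refine ⟨(c : MvPolynomial ι k) * f, ?_⟩
    have : ∀ σ : ↥G, galAct (σ : Matrix.GeneralLinearGroup ι k) ((c : MvPolynomial ι k) * f)
        = (c : MvPolynomial ι k) * galAct (σ : Matrix.GeneralLinearGroup ι k) f := by
      intro σ
      rw [map_mul, c.2 (σ : Matrix.GeneralLinearGroup ι k) σ.2]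
    rw [transfer, Finset.sum_congr rfl (fun σ _ => this σ), ← Finset.mul_sum]
    show (c : MvPolynomial ι k) * transfer G f
        = ((c * x : ↥(invariants G)) : MvPolynomial ι k)
    rw [hf]; rfl

section FiniteGroupAction

variable {Γ S : Type*} [CommGroup Γ] [Fintype Γ] [CommRing S] [MulSemiringAction Γ S]

/-- The elements of `Γ` acting trivially modulo `ℓ`. -/
def inertiaOf (Γ : Type*) {S : Type*} [CommGroup Γ] [CommRing S] [MulSemiringAction Γ S]
    (ℓ : S) : Subgroup Γ where
  carrier := {h | ∀ s : S, ℓ ∣ h • s - s}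
  one_mem' s := by simp
  mul_mem' {g h} hg hh s := by
    have := dvd_add (hg (h • s)) (hh s)
    rwa [sub_add_sub_cancel, ← mul_smul] at this
  inv_mem' {g} hg s := by
    have := hg (g⁻¹ • s)
    rwa [smul_inv_smul, dvd_sub_comm] at this

theorem dvd_sum_prod_sub_smul {D x : S} (hD : ∀ s : S, D ∣ ∑ h : Γ, h • (x * s))
    (T : Finset Γ) (c y : Γ → S) (s : S) :
    D ∣ ∑ h : Γ, (∏ g ∈ T, (c g - h • y g)) * h • (x * s) := by
  classical
  induction T using Finset.induction_on generalizing s with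
  | empty => simpa using hD s
  | insert a T ha ih =>
    have : ∑ h : Γ, (∏ g ∈ insert a T, (c g - h • y g)) * h • (x * s) =
        c a * ∑ h : Γ, (∏ g ∈ T, (c g - h • y g)) * h • (x * s) -
          ∑ h : Γ, (∏ g ∈ T, (c g - h • y g)) * h • (x * (y a * s)) := by
      rw [Finset.mul_sum, ← Finset.sum_sub_distrib]
      refine Finset.sum_congr rfl fun h _ => ?_
      rw [Finset.prod_insert ha]
      simp only [smul_mul']
      ring
    rw [this]
    exact dvd_sub (Dvd.dvd.mul_left (ih s) _) (ih _)

/-- Modulo powers of a prime `ℓ`, divisibility of a transfer over `Γ` localises to the transfer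
over the inertia group of `ℓ`. -/
theorem pow_dvd_sum_inertia [IsDomain S] {p : ℕ} [Fact p.Prime] [CharP S p] (hΓ : IsPGroup p Γ)
    {ℓ : S} (hℓ : Prime ℓ) {D x : S} (hD : ∀ s : S, D ∣ ∑ h : Γ, h • (x * s)) {e : ℕ}
    (he : ℓ ^ e ∣ D) {I : Subgroup Γ} (hI : I = inertiaOf Γ ℓ) [Fintype I] (s : S) :
    ℓ ^ e ∣ ∑ h : I, (h : Γ) • (x * s) := by
  classical
  replace hI : ∀ h, h ∈ I ↔ ∀ s : S, ℓ ∣ h • s - s := fun h => by rw [hI]; rfl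
  have hex : ∀ g : Γ, ∃ y : S, g ∉ I → ¬ ℓ ∣ g • y - y := by
    intro g
    by_cases hg : g ∈ I
    · exact ⟨0, fun h => absurd hg h⟩
    · have := hg
      rw [hI] at this
      push Not at this
      exact ⟨this.choose, fun _ => this.choose_spec⟩
  choose y hy using hex
  let N : Γ → S := fun g => ∏ h : I, (h : Γ) • y g
  have hN : ∀ h ∈ I, ∀ g, h • N g = N g := by
    intro h hh g
    simp only [N, Finset.smul_prod', ← mul_smul]
    exact Fintype.prod_equiv (Equiv.mulLeft (⟨h, hh⟩ : I)) _ _ fun _ => rfl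
  obtain ⟨m, hm⟩ := (hΓ.to_subgroup I).exists_card_eq
  have hmod : ∀ z : S, ℓ ∣ (∏ h : I, (h : Γ) • z) - z ^ p ^ m := by
    intro z
    rw [← Ideal.mem_span_singleton, ← Ideal.Quotient.eq, map_prod, map_pow]
    rw [← hm, Nat.card_eq_fintype_card, ← Finset.card_univ, ← Finset.prod_const]
    refine Finset.prod_congr rfl fun h _ => ?_
    rw [Ideal.Quotient.eq, Ideal.mem_span_singleton]
    exact (hI _).1 h.2 z
  have hgN : ∀ g ∉ I, ¬ ℓ ∣ g • N g - N g := by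
    intro g hg hdvd
    have h1 : g • N g = ∏ h : I, (h : Γ) • (g • y g) := by
      simp only [N, Finset.smul_prod']
      exact Finset.prod_congr rfl fun h _ => smul_comm _ _ _
    have h2 := hmod (g • y g)
    rw [← h1] at h2
    have h3 := hmod (y g)
    have h4 : ℓ ∣ (g • y g - y g) ^ p ^ m := by
      rw [sub_pow_char_pow]
      have := dvd_add (dvd_sub hdvd h2) h3
      convert this using 1
      simp only [N]
      ring
    exact hy g hg (hℓ.dvd_of_dvd_pow h4)
  let T : Finset Γ := Finset.univ.filter (· ∉ I)
  have key := dvd_sum_prod_sub_smul hD T (fun g => g • N g) N s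
  have hsum : ∑ h : Γ, (∏ g ∈ T, (g • N g - h • N g)) * h • (x * s) =
      (∏ g ∈ T, (g • N g - N g)) * ∑ h : I, (h : Γ) • (x * s) := by
    rw [← Finset.sum_filter_add_sum_filter_not Finset.univ (· ∈ I)]
    have h0 : ∑ h ∈ Finset.univ.filter (¬ · ∈ I),
        (∏ g ∈ T, (g • N g - h • N g)) * h • (x * s) = 0 := by
      refine Finset.sum_eq_zero fun h hh => ?_
      rw [Finset.prod_eq_zero hh (sub_self _), zero_mul]
    rw [h0, add_zero, Finset.mul_sum]
    rw [Finset.sum_subtype (p := (· ∈ I)) _ (by simp)]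
    refine Fintype.sum_congr _ _ fun h => ?_
    congr 1
    exact Finset.prod_congr rfl fun g _ => by rw [hN h.1 h.2]
  rw [hsum] at key
  refine hℓ.pow_dvd_of_dvd_mul_left e ?_ (he.trans key)
  rw [Prime.dvd_finsetProd_iff hℓ]
  rintro ⟨g, hg, hd⟩
  exact hgN g (by simpa [T] using hg) hd

theorem sum_eq_sum_quotient_smul (H : Subgroup Γ) [Fintype H] [Fintype (Γ ⧸ H)] (s : S) :
    ∑ g : Γ, g • s = ∑ q : Γ ⧸ H, q.out • ∑ h : H, (h : Γ) • s := by
  simp only [Finset.smul_sum, ← mul_smul]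
  rw [← Fintype.sum_prod_type' (f := fun (q : Γ ⧸ H) (h : H) => (q.out * (h : Γ)) • s)]
  refine (Function.Bijective.sum_comp (e := fun x : (Γ ⧸ H) × H => x.1.out * (x.2 : Γ))
    ⟨?_, ?_⟩ fun g => g • s).symm
  · rintro ⟨q, h⟩ ⟨q', h'⟩ hqh
    have hq : q = q' := by
      have := congrArg (QuotientGroup.mk (s := H)) hqh
      simpa [QuotientGroup.mk_mul_of_mem] using this
    subst hq
    simpa using hqh
  · intro g
    refine ⟨⟨g, ⟨((g : Γ ⧸ H).out)⁻¹ * g, ?_⟩⟩, by simp⟩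
    rw [← QuotientGroup.eq, QuotientGroup.out_eq']

theorem dvd_sum_of_dvd_sum_subgroup {H K : Subgroup Γ} (hHK : H ≤ K) [Fintype H] [Fintype K]
    {d x : S} (hd : ∀ s : S, d ∣ ∑ h : H, (h : Γ) • (x * s))
    (hx : ∀ g ∈ K, g • x = x) (s : S) :
    d ∣ ∑ h : K, (h : Γ) • (x * s) := by
  classical
  have := Fintype.ofFinite (K ⧸ H.subgroupOf K)
  have := Fintype.ofFinite (H.subgroupOf K)
  have h1 : ∑ h : K, (h : Γ) • (x * s) =
      ∑ q : K ⧸ H.subgroupOf K, ∑ h : H, (h : Γ) • (x * ((q.out : K) : Γ) • s) := by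
    have h2 : ∑ h : K, (h : Γ) • (x * s) = ∑ h : K, h • (x * s) := rfl
    rw [h2, sum_eq_sum_quotient_smul (H.subgroupOf K)]
    refine Fintype.sum_congr _ _ fun q => ?_
    rw [Finset.smul_sum]
    refine Fintype.sum_equiv (Subgroup.subgroupOfEquivOfLe hHK).toEquiv _ _ fun h => ?_
    have h3 : ((q.out : K) : Γ) • x = x := hx _ q.out.2
    change ((q.out : K) : Γ) • ((h : K) : Γ) • (x * s) = ((h : K) : Γ) • _
    rw [smul_comm, smul_mul', h3]
  rw [h1]
  exact Finset.dvd_sum fun q _ => hd _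

end FiniteGroupAction

theorem dvd_of_forall_prime_pow_dvd {R : Type*} [CommRing R] [IsDomain R]
    [UniqueFactorizationMonoid R] {a b : R} (ha : a ≠ 0)
    (h : ∀ (ℓ : R) (e : ℕ), Prime ℓ → ℓ ^ e ∣ a → ℓ ^ e ∣ b) : a ∣ b := by
  rw [UniqueFactorizationMonoid.dvd_iff_emultiplicity_le ha]
  intro ℓ hℓ
  exact emultiplicity_le_emultiplicity_iff.2 fun e he => h ℓ e hℓ he

/-- An action on a polynomial ring which is induced by a linear action on linear forms. -/
structure IsLinearAction (Γ σ k : Type*) [Field k] [Group Γ]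
    [MulSemiringAction Γ (MvPolynomial σ k)] : Prop where
  smul_C : ∀ (g : Γ) (c : k), g • (C c : MvPolynomial σ k) = C c
  smul_X : ∀ (g : Γ) (i : σ), (g • (X i : MvPolynomial σ k)).IsHomogeneous 1

section LinearAction

variable {Γ σ k : Type*} [Field k] [CommGroup Γ] [MulSemiringAction Γ (MvPolynomial σ k)]

namespace IsLinearAction

theorem smul_eq_aeval (hΓ : IsLinearAction Γ σ k) (g : Γ) (f : MvPolynomial σ k) :
    g • f = aeval (fun i => g • (X i : MvPolynomial σ k)) f := by
  have : MulSemiringAction.toRingHom Γ (MvPolynomial σ k) g =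
      (aeval (fun i => g • (X i : MvPolynomial σ k)) : _ →ₐ[k] _).toRingHom := by
    ext i
    · simp [hΓ.smul_C]
    · simp
  exact congrArg (fun φ : MvPolynomial σ k →+* MvPolynomial σ k => φ f) this

theorem isHomogeneous_smul (hΓ : IsLinearAction Γ σ k) (g : Γ) {f : MvPolynomial σ k} {d : ℕ}
    (hf : f.IsHomogeneous d) : (g • f).IsHomogeneous d := by
  rw [hΓ.smul_eq_aeval]
  simpa using hf.aeval (fun i => g • (X i : MvPolynomial σ k)) (fun i => hΓ.smul_X g i)

theorem homogeneousComponent_smul (hΓ : IsLinearAction Γ σ k) (g : Γ) (f : MvPolynomial σ k)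
    (d : ℕ) : homogeneousComponent d (g • f) = g • homogeneousComponent d f := by
  conv_lhs => rw [← sum_homogeneousComponent f, Finset.smul_sum, map_sum]
  simp only [homogeneousComponent_of_mem
    (hΓ.isHomogeneous_smul g (homogeneousComponent_isHomogeneous _ f))]
  rw [Finset.sum_ite_eq]
  split_ifs with h
  · rfl
  · rw [homogeneousComponent_eq_zero _ _ (by simpa using h), smul_zero]

theorem smul_eq_self_of_forall_X (hΓ : IsLinearAction Γ σ k) {g : Γ}
    (h : ∀ i, g • (X i : MvPolynomial σ k) = X i) (f : MvPolynomial σ k) : g • f = f := by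
  rw [hΓ.smul_eq_aeval]
  simp [h]

theorem homogeneousComponent_sum_smul [Fintype Γ] (hΓ : IsLinearAction Γ σ k)
    (f : MvPolynomial σ k) (d : ℕ) :
    homogeneousComponent d (∑ g : Γ, g • f) = ∑ g : Γ, g • homogeneousComponent d f := by
  simp only [map_sum, hΓ.homogeneousComponent_smul]

end IsLinearAction

theorem eq_C_mul_of_prime_dvd_of_isHomogeneous_one {ℓ v : MvPolynomial σ k} (hℓ : Prime ℓ)
    (hv : v.IsHomogeneous 1) (hdv : ℓ ∣ v) : ∃ c, v = C c * ℓ := by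
  have hℓ1 : 1 ≤ ℓ.totalDegree := by
    by_contra! h
    have h0 : ℓ.totalDegree = 0 := by omega
    rw [totalDegree_eq_zero_iff_eq_C] at h0
    refine hℓ.not_isUnit ?_
    rw [h0]
    refine (IsUnit.mk0 _ fun h => hℓ.ne_zero ?_).map C
    rw [h0, h, C_0]
  rcases eq_or_ne v 0 with rfl | hv0
  · exact ⟨0, by simp⟩
  obtain ⟨t, rfl⟩ := hdv
  have ht : t ≠ 0 := right_ne_zero_of_mul hv0
  have := hv.totalDegree hv0
  rw [totalDegree_mul_of_isDomain hℓ.ne_zero ht] at this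
  have h0 : t.totalDegree = 0 := by omega
  rw [totalDegree_eq_zero_iff_eq_C] at h0
  exact ⟨_, by rw [← h0, mul_comm]⟩

variable {p : ℕ} [Fact p.Prime] [CharP k p]

theorem smul_eq_self_of_smul_eq_C_mul (hlin : IsLinearAction Γ σ k) [Finite Γ]
    (hΓ : IsPGroup p Γ) {u : MvPolynomial σ k} (hu : u ≠ 0) {g : Γ} {c : k}
    (h : g • u = C c * u) : g • u = u := by
  have hpow : ∀ m : ℕ, g ^ m • u = C (c ^ m) * u := by
    intro m
    induction m with
    | zero => simp
    | succ m ih =>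
      rw [pow_succ', mul_smul, ih, smul_mul', hlin.smul_C, h, pow_succ, C_mul, mul_assoc]
  obtain ⟨m, hm⟩ := hΓ g
  have h1 := hpow (p ^ m)
  rw [hm, one_smul] at h1
  have h2 : C (c ^ p ^ m) = (1 : MvPolynomial σ k) :=
    mul_right_cancel₀ hu (by rw [one_mul]; exact h1.symm)
  have h3 : c ^ p ^ m = 1 := by
    rw [← C_1] at h2
    exact C_injective _ _ h2
  have h4 : (c - 1) ^ p ^ m = 0 := by rw [sub_pow_char_pow, h3, one_pow, sub_self]
  have h5 : c = 1 := sub_eq_zero.1 (pow_eq_zero_iff (pow_ne_zero _ (Fact.out : p.Prime).ne_zero) |>.1 h4)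
  rw [h, h5, C_1, one_mul]

/-- A prime with nontrivial inertia group is invariant, and the inertia group moves linear
forms by invariants. -/
theorem smul_eq_self_of_mem_inertiaOf [Finite Γ] [FaithfulSMul Γ (MvPolynomial σ k)]
    (hlin : IsLinearAction Γ σ k) (hΓ : IsPGroup p Γ) {ℓ : MvPolynomial σ k} (hℓ : Prime ℓ)
    {h : Γ} (hh : h ∈ inertiaOf Γ ℓ) (hh1 : h ≠ 1) (g : Γ) :
    g • ℓ = ℓ ∧ ∀ i, g • (h • (X i : MvPolynomial σ k) - X i) = h • X i - X i := by
  replace hh : ∀ s, ℓ ∣ h • s - s := hh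
  have hhom : ∀ (g : Γ) (i : σ),
      IsHomogeneous (h • (g • (X i : MvPolynomial σ k)) - g • X i) 1 := fun g i =>
    (hlin.isHomogeneous_smul h (hlin.smul_X g i)).sub (hlin.smul_X g i)
  obtain ⟨i, hi⟩ : ∃ i, h • (X i : MvPolynomial σ k) - X i ≠ 0 := by
    by_contra! hall
    refine hh1 (FaithfulSMul.eq_of_smul_eq_smul (α := MvPolynomial σ k) fun f => ?_)
    rw [one_smul]
    exact hlin.smul_eq_self_of_forall_X (fun i => sub_eq_zero.1 (hall i)) f
  have hi1 : (h • (X i : MvPolynomial σ k) - X i).IsHomogeneous 1 := by simpa using hhom 1 i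
  have hmul : ∀ v : MvPolynomial σ k, v.IsHomogeneous 1 → ℓ ∣ v → ∃ c, v = C c * ℓ :=
    fun v hv hdv => eq_C_mul_of_prime_dvd_of_isHomogeneous_one hℓ hv hdv
  obtain ⟨c, hc⟩ := hmul _ hi1 (hh _)
  have hc0 : c ≠ 0 := by
    rintro rfl
    exact hi (by rw [hc]; simp)
  have hgℓ : g • ℓ = ℓ := by
    obtain ⟨c', hc'⟩ := hmul _ (hhom g i) (hh _)
    have h1 : g • (C c * ℓ) = C c' * ℓ := by
      rw [← hc, ← hc', smul_sub, smul_comm]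
    rw [smul_mul', hlin.smul_C] at h1
    refine smul_eq_self_of_smul_eq_C_mul hlin hΓ hℓ.ne_zero (c := c⁻¹ * c') ?_
    rw [C_mul, mul_assoc, ← h1, ← mul_assoc, ← C_mul, inv_mul_cancel₀ hc0, C_1, one_mul]
  refine ⟨hgℓ, fun j => ?_⟩
  obtain ⟨c', hc'⟩ := hmul _ (by simpa using hhom 1 j) (hh (X j))
  rw [hc', smul_mul', hlin.smul_C, hgℓ]

theorem exists_sum_smul_ne_zero (Γ σ k : Type*) [Field k] [CommGroup Γ] [Fintype Γ]
    [MulSemiringAction Γ (MvPolynomial σ k)] [FaithfulSMul Γ (MvPolynomial σ k)] :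
    ∃ s : MvPolynomial σ k, ∑ g : Γ, g • s ≠ 0 := by
  by_contra! h
  have hinj : Function.Injective
      fun g : Γ => ((MulSemiringAction.toRingHom Γ (MvPolynomial σ k) g :
        MvPolynomial σ k →+* MvPolynomial σ k) : MvPolynomial σ k →* MvPolynomial σ k) :=
    fun g g' hg => FaithfulSMul.eq_of_smul_eq_smul (α := MvPolynomial σ k)
      fun s => by simpa using DFunLike.congr_fun hg s
  have hli := (linearIndependent_monoidHom (MvPolynomial σ k) (MvPolynomial σ k)).comp _ hinj
  rw [Fintype.linearIndependent_iff] at hli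
  refine one_ne_zero (hli (fun _ => 1) ?_ 1)
  ext1 s
  simpa using h s

/-- A generator of the image of the transfer is homogeneous. -/
theorem isHomogeneous_of_transfer_dvd [Fintype Γ] (hlin : IsLinearAction Γ σ k)
    {D b : MvPolynomial σ k} (hb : ∑ g : Γ, g • b = D) (hD : ∀ s, D ∣ ∑ g : Γ, g • s) :
    D.IsHomogeneous D.totalDegree := by
  rcases eq_or_ne D 0 with rfl | hD0
  · exact isHomogeneous_zero _ _ _
  obtain ⟨j, hj, h1⟩ : ∃ j ∈ Finset.range (D.totalDegree + 1), homogeneousComponent j D ≠ 0 := by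
    by_contra! h
    exact hD0 (by rw [← sum_homogeneousComponent D, Finset.sum_eq_zero h])
  have h2 : D ∣ homogeneousComponent j D := by
    conv_rhs => rw [← hb, hlin.homogeneousComponent_sum_smul]
    exact hD _
  obtain ⟨t, ht⟩ := h2
  have ht0 : t ≠ 0 := by rintro rfl; exact h1 (by rw [ht, mul_zero])
  have h3 := (homogeneousComponent_isHomogeneous j D).totalDegree h1
  rw [ht, totalDegree_mul_of_isDomain hD0 ht0] at h3
  rw [Finset.mem_range] at hj
  have h0 : t.totalDegree = 0 := by omega
  obtain rfl : j = D.totalDegree := by omega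
  rw [totalDegree_eq_zero_iff_eq_C] at h0
  have hc : coeff 0 t ≠ 0 := fun h => ht0 (by rw [h0, h, C_0])
  have h4 : D = C (coeff 0 t)⁻¹ * homogeneousComponent D.totalDegree D := by
    rw [ht, mul_left_comm]
    conv_rhs => rw [h0]
    rw [coeff_zero_C, ← C_mul, inv_mul_cancel₀ hc, C_1, mul_one]
  have := (homogeneousComponent_isHomogeneous D.totalDegree D).C_mul (coeff 0 t)⁻¹
  rwa [← h4] at this

end LinearAction

section LinearAction

variable {Γ σ k : Type*} [Field k] [CommGroup Γ] [MulSemiringAction Γ (MvPolynomial σ k)]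

/-- The elements moving each variable by an invariant linear form. -/
def bireflectionSubgroup (Γ σ k : Type*) [Field k] [CommGroup Γ]
    [MulSemiringAction Γ (MvPolynomial σ k)] : Subgroup Γ where
  carrier := {g | ∀ (i : σ) (h : Γ), h • (g • (X i : MvPolynomial σ k) - X i) = g • X i - X i}
  one_mem' i h := by simp
  mul_mem' {g g'} hg hg' i h := by
    have : (g * g') • (X i : MvPolynomial σ k) - X i = (g • X i - X i) + (g' • X i - X i) := by
      rw [← hg i g', smul_sub, mul_smul, smul_comm g g']
      ring
    rw [this, smul_add, hg i h, hg' i h]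
  inv_mem' {g} hg i h := by
    have : g⁻¹ • (X i : MvPolynomial σ k) - X i = -(g • X i - X i) := by
      rw [← hg i g⁻¹, smul_sub, inv_smul_smul]
      ring
    rw [this, smul_neg, hg i h]

theorem smul_eq_of_sum_smul_eq [Fintype Γ] {D b : MvPolynomial σ k} (hb : ∑ g : Γ, g • b = D)
    (g : Γ) : g • D = D := by
  rw [← hb, Finset.smul_sum]
  exact Fintype.sum_equiv (Equiv.mulLeft g) _ _ fun h => by simp [mul_smul]

/-- The generator of a principal transfer image is the transfer of a homogeneous polynomial. -/
theorem exists_isHomogeneous_sum_smul_eq [Fintype Γ] (hlin : IsLinearAction Γ σ k)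
    {D b : MvPolynomial σ k} (hb : ∑ g : Γ, g • b = D) (hD : ∀ s, D ∣ ∑ g : Γ, g • s) :
    ∃ b' : MvPolynomial σ k, b'.IsHomogeneous D.totalDegree ∧ ∑ g : Γ, g • b' = D := by
  refine ⟨homogeneousComponent D.totalDegree b, homogeneousComponent_isHomogeneous _ _, ?_⟩
  rw [← hlin.homogeneousComponent_sum_smul, hb,
    homogeneousComponent_of_mem (isHomogeneous_of_transfer_dvd hlin hb hD), if_pos rfl]

variable {p : ℕ} [Fact p.Prime] [CharP k p]

/-- If the image of the transfer is principal, then every group element moves the variables by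
invariant linear forms. -/
theorem bireflectionSubgroup_eq_top [Fintype Γ] [FaithfulSMul Γ (MvPolynomial σ k)]
    (hlin : IsLinearAction Γ σ k) (hΓ : IsPGroup p Γ)
    {D b : MvPolynomial σ k} (hb : ∑ g : Γ, g • b = D) (hD : ∀ s, D ∣ ∑ g : Γ, g • s)
    (hD0 : D ≠ 0) : bireflectionSubgroup Γ σ k = ⊤ := by
  classical
  obtain ⟨b', hb'h, hb'⟩ := exists_isHomogeneous_sum_smul_eq hlin hb hD
  set W := bireflectionSubgroup Γ σ k with hW
  have hle : ∀ ℓ : MvPolynomial σ k, Prime ℓ → inertiaOf Γ ℓ ≤ W := by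
    intro ℓ hℓ h hh
    rcases eq_or_ne h 1 with rfl | hh1
    · exact one_mem _
    · exact fun i g => (smul_eq_self_of_mem_inertiaOf hlin hΓ hℓ hh hh1 g).2 i
  have ht : D ∣ ∑ w : W, (w : Γ) • b' := by
    refine dvd_of_forall_prime_pow_dvd hD0 fun ℓ e hℓ he => ?_
    have := dvd_sum_of_dvd_sum_subgroup (x := (1 : MvPolynomial σ k)) (hle ℓ hℓ)
      (pow_dvd_sum_inertia hΓ hℓ (x := 1) (by simpa using hD) he rfl) (by simp) b'
    simpa using this
  have := Fintype.ofFinite (Γ ⧸ W)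
  have hsum := sum_eq_sum_quotient_smul W b'
  rw [hb'] at hsum
  have hthom : (∑ w : W, (w : Γ) • b').IsHomogeneous D.totalDegree :=
    IsHomogeneous.sum _ _ _ fun w _ => hlin.isHomogeneous_smul _ hb'h
  obtain ⟨u, hu⟩ := ht
  rw [hu] at hthom hsum
  have hDu : D * u ≠ 0 := by
    intro h
    rw [h] at hsum
    exact hD0 (by simpa using hsum)
  have hdeg := hthom.totalDegree hDu
  rw [totalDegree_mul_of_isDomain hD0 (right_ne_zero_of_mul hDu)] at hdeg
  have hu0 : u.totalDegree = 0 := by omega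
  rw [totalDegree_eq_zero_iff_eq_C] at hu0
  have hinv : ∀ g : Γ, g • (D * u) = D * u := by
    intro g
    rw [smul_mul', smul_eq_of_sum_smul_eq hb, hu0, hlin.smul_C]
  simp only [hinv, Finset.sum_const, Finset.card_univ] at hsum
  by_contra hne
  obtain ⟨m, hm⟩ := hΓ.index W
  have hm0 : m ≠ 0 := by
    rintro rfl
    exact hne (Subgroup.index_eq_one.1 (by simpa using hm))
  have hp : (p : MvPolynomial σ k) = 0 := CharP.cast_eq_zero _ p
  rw [← Nat.card_eq_fintype_card, ← Subgroup.index_eq_card, hm, nsmul_eq_mul, Nat.cast_pow,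
    hp, zero_pow hm0, zero_mul] at hsum
  exact hD0 hsum

end LinearAction

section LeadingTerms

open MonomialOrder

variable {σ R : Type*} [CommRing R] {m : MonomialOrder σ}

/-- `f` is the monomial with exponent `α` plus smaller terms. -/
def LeadsWith (m : MonomialOrder σ) (f : MvPolynomial σ R) (α : σ →₀ ℕ) : Prop :=
  coeff α f = 1 ∧ m.degree f ≼[m] α

theorem LeadsWith.mul {f g : MvPolynomial σ R} {α β : σ →₀ ℕ} (hf : LeadsWith m f α)
    (hg : LeadsWith m g β) : LeadsWith m (f * g) (α + β) := by
  refine ⟨?_, m.toSyn_degree_mul_le.trans ?_⟩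
  · rw [m.coeff_mul_of_add_of_degree_le hf.2 hg.2, hf.1, hg.1, one_mul]
  · rw [map_add]
    exact add_le_add hf.2 hg.2

theorem LeadsWith.monomial (α : σ →₀ ℕ) :
    LeadsWith m (MvPolynomial.monomial α (1 : R)) α :=
  ⟨by classical rw [coeff_monomial, if_pos rfl], m.degree_monomial_le 1⟩

theorem LeadsWith.one : LeadsWith m (1 : MvPolynomial σ R) 0 := LeadsWith.monomial 0

theorem LeadsWith.pow {f : MvPolynomial σ R} {α : σ →₀ ℕ} (hf : LeadsWith m f α) (n : ℕ) :
    LeadsWith m (f ^ n) (n • α) := by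
  induction n with
  | zero => simpa using LeadsWith.one
  | succ n ih => rw [pow_succ, succ_nsmul]; exact ih.mul hf

theorem LeadsWith.prod {ι : Type*} (s : Finset ι) {f : ι → MvPolynomial σ R} {α : ι → σ →₀ ℕ}
    (hf : ∀ i, LeadsWith m (f i) (α i)) : LeadsWith m (∏ i ∈ s, f i) (∑ i ∈ s, α i) := by
  classical
  induction s using Finset.induction_on with
  | empty => simpa using LeadsWith.one
  | insert i s hi ih => rw [Finset.prod_insert hi, Finset.sum_insert hi]; exact (hf i).mul ih

theorem LeadsWith.le_of_coeff_ne_zero {f : MvPolynomial σ R} {α β : σ →₀ ℕ}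
    (hf : LeadsWith m f α) (h : coeff β f ≠ 0) : β ≼[m] α :=
  (m.le_degree (mem_support_iff.2 h)).trans hf.2

theorem LeadsWith.map {S : Type*} [CommRing S] (φ : R →+* S) {f : MvPolynomial σ R} {α : σ →₀ ℕ}
    (hf : LeadsWith m f α) : LeadsWith m (MvPolynomial.map φ f) α := by
  refine ⟨by rw [coeff_map, hf.1, map_one], m.degree_le_iff.2 fun β hβ => ?_⟩
  refine hf.le_of_coeff_ne_zero fun h => ?_
  rw [mem_support_iff, coeff_map, h, map_zero] at hβ
  exact hβ rfl

theorem injective_linearCombination_of_leadsWith {b : (σ →₀ ℕ) → MvPolynomial σ R}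
    (hb : ∀ α, LeadsWith m (b α) α) :
    Function.Injective (Finsupp.linearCombination R b) := by
  rw [← LinearMap.ker_eq_bot, LinearMap.ker_eq_bot']
  intro v hv
  by_contra hv0
  obtain ⟨α, hα, hmax⟩ := Finset.exists_max_image v.support m.toSyn
    (Finsupp.support_nonempty_iff.2 hv0)
  have h := congrArg (coeff α) hv
  rw [Finsupp.linearCombination_apply, Finsupp.sum, coeff_sum, Finset.sum_eq_single_of_mem α hα,
    coeff_smul, (hb α).1, coeff_zero, smul_eq_mul, mul_one] at h
  · exact Finsupp.mem_support_iff.1 hα h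
  · intro β hβ hne
    rw [coeff_smul, smul_eq_mul]
    by_contra h0
    exact hne (m.toSyn.injective
      ((hmax β hβ).antisymm ((hb β).le_of_coeff_ne_zero (right_ne_zero_of_mul h0))))

theorem surjective_linearCombination_of_leadsWith {b : (σ →₀ ℕ) → MvPolynomial σ R}
    (hb : ∀ α, LeadsWith m (b α) α) :
    Function.Surjective (Finsupp.linearCombination R b) := by
  suffices ∀ (d : m.syn) (f : MvPolynomial σ R), m.toSyn (m.degree f) = d →
      ∃ v, Finsupp.linearCombination R b v = f from fun f => this _ f rfl
  intro d
  induction d using WellFoundedLT.induction with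
  | ind d ih =>
    rintro f rfl
    set f' := f - m.leadingCoeff f • b (m.degree f) with hf'
    suffices h : ∃ v, Finsupp.linearCombination R b v = f' by
      obtain ⟨v, hv⟩ := h
      refine ⟨v + Finsupp.single (m.degree f) (m.leadingCoeff f), ?_⟩
      rw [map_add, hv, Finsupp.linearCombination_single, hf', sub_add_cancel]
    rcases eq_or_ne f' 0 with h0 | h0
    · exact ⟨0, by rw [h0, map_zero]⟩
    refine ih _ (lt_of_le_of_ne ?_ ?_) f' rfl
    · refine m.degree_sub_le.trans (sup_le le_rfl ?_)
      exact m.degree_smul_le.trans (hb _).2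
    · intro h
      have h1 := m.degree_mem_support h0
      rw [m.toSyn.injective h, mem_support_iff, hf', coeff_sub, coeff_smul, (hb _).1] at h1
      exact h1 (by simp [leadingCoeff])

variable [Finite σ]

/-- Polynomials whose leading terms are powers of distinct variables form a Gröbner basis. -/
theorem eq_zero_of_mem_span_of_reduced {a : σ → MvPolynomial σ R} {q : σ → ℕ}
    (hq : ∀ i, 0 < q i) (ha : ∀ i, LeadsWith m (a i) (Finsupp.single i (q i)))
    {r : MvPolynomial σ R} (hr : r ∈ Ideal.span (Set.range a))
    (hred : ∀ α, coeff α r ≠ 0 → ∀ i, α i < q i) : r = 0 := by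
  classical
  have := Fintype.ofFinite σ
  let rem : (σ →₀ ℕ) → (σ →₀ ℕ) := fun α => Finsupp.equivFunOnFinite.symm fun i => α i % q i
  let b : (σ →₀ ℕ) → MvPolynomial σ R := fun α =>
    (∏ i, a i ^ (α i / q i)) * MvPolynomial.monomial (rem α) 1
  have hb : ∀ α, LeadsWith m (b α) α := by
    intro α
    have h1 : α = (∑ i, (α i / q i) • Finsupp.single i (q i)) + rem α := by
      ext j
      simp [rem, Finsupp.single_apply, Nat.div_add_mod']
    have := (LeadsWith.prod Finset.univ fun i => (ha i).pow (α i / q i)).mul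
      (LeadsWith.monomial (R := R) (m := m) (rem α))
    rwa [← h1] at this
  have hmul : ∀ i α, a i * b α = b (α + Finsupp.single i (q i)) := by
    intro i α
    have h1 : rem (α + Finsupp.single i (q i)) = rem α := by
      ext j
      rcases eq_or_ne i j with rfl | hij
      · simp [rem]
      · simp [rem, Finsupp.single_apply, hij]
    simp only [b, h1]
    rw [← mul_assoc]
    congr 1
    rw [← Finset.mul_prod_erase _ _ (Finset.mem_univ i), ← mul_assoc, ← pow_succ',
      ← Finset.mul_prod_erase (a := i) (h := Finset.mem_univ i)]
    congr 1
    · simp [Nat.add_div_right _ (hq i)]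
    · refine Finset.prod_congr rfl fun j hj => ?_
      simp [(Finset.ne_of_mem_erase hj).symm]
  have hmulΦ : ∀ i v, a i * Finsupp.linearCombination R b v =
      Finsupp.linearCombination R b (v.mapDomain (· + Finsupp.single i (q i))) := by
    intro i v
    rw [Finsupp.linearCombination_mapDomain, Finsupp.linearCombination_apply,
      Finsupp.linearCombination_apply, Finsupp.sum, Finsupp.sum, Finset.mul_sum]
    refine Finset.sum_congr rfl fun α _ => ?_
    rw [mul_smul_comm, hmul, Function.comp_apply]
  have hspan : r ∈ (Finsupp.supported R R {α : σ →₀ ℕ | ∃ i, q i ≤ α i}).map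
      (Finsupp.linearCombination R b) := by
    obtain ⟨c, rfl⟩ := Ideal.mem_span_range_iff_exists_fun.1 hr
    refine Submodule.sum_mem _ fun i _ => ?_
    obtain ⟨v, hv⟩ := surjective_linearCombination_of_leadsWith hb (c i)
    rw [← hv, mul_comm, hmulΦ]
    refine Submodule.mem_map_of_mem ?_
    rw [Finsupp.mem_supported]
    intro α hα
    obtain ⟨β, -, rfl⟩ := Finset.mem_image.1 (Finsupp.mapDomain_support hα)
    exact ⟨i, by simp⟩
  obtain ⟨v, hv, hvr⟩ := hspan
  have hr' : Finsupp.linearCombination R b (Finsupp.onFinset r.support (fun α => coeff α r)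
      fun α hα => mem_support_iff.2 hα) = r := by
    rw [Finsupp.linearCombination_apply, Finsupp.onFinset_sum _ (by simp)]
    conv_rhs => rw [as_sum r]
    refine Finset.sum_congr rfl fun α hα => ?_
    have hα' := hred α (mem_support_iff.1 hα)
    have h1 : rem α = α := by ext i; simp [rem, Nat.mod_eq_of_lt (hα' i)]
    simp [b, h1, Nat.div_eq_of_lt (hα' _), smul_monomial]
  have hv' := injective_linearCombination_of_leadsWith hb (hvr.trans hr'.symm)
  ext α
  by_contra h0
  have h1 : v α = coeff α r := by rw [hv']; rfl
  rw [coeff_zero, ← h1] at h0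
  obtain ⟨i, hi⟩ := (Finsupp.mem_supported R v).1 hv (Finsupp.mem_support_iff.2 h0)
  exact absurd (hred α (h1 ▸ h0) i) (not_lt.2 hi)

end LeadingTerms

section Shift

variable {σ k : Type*} [Field k]

/-- The substitution `x ↦ x + y`, with `x` in the coefficients and `y` the new variables. -/
noncomputable def shiftHom (σ k : Type*) [Field k] :
    MvPolynomial σ k →ₐ[k] MvPolynomial σ (MvPolynomial σ k) :=
  aeval fun i => C (X i) + X i

theorem prod_monomial_eq {τ ι R : Type*} [CommSemiring R] (s : Finset ι) (α : ι → τ →₀ ℕ)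
    (c : ι → R) :
    ∏ i ∈ s, monomial (α i) (c i) = monomial (∑ i ∈ s, α i) (∏ i ∈ s, c i) := by
  classical
  induction s using Finset.induction_on with
  | empty => simp
  | insert i s hi ih =>
    rw [Finset.prod_insert hi, Finset.sum_insert hi, Finset.prod_insert hi, ih, monomial_mul]

theorem coeff_coeff_shiftHom [Fintype σ] (f : MvPolynomial σ k) (β γ : σ →₀ ℕ) :
    coeff γ (coeff β (shiftHom σ k f)) =
      (∏ i, ((β + γ) i).choose (β i) : ℕ) * coeff (β + γ) f := by
  classical
  induction f using MvPolynomial.induction_on' with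
  | add f g hf hg =>
    rw [map_add, coeff_add, coeff_add, coeff_add, mul_add, hf, hg]
  | monomial α c =>
    have h1 : ∀ (i : σ) (n : ℕ), (C (X i) + X i : MvPolynomial σ (MvPolynomial σ k)) ^ n =
        ∑ j ∈ Finset.range (n + 1), monomial (Finsupp.single i j)
          (monomial (Finsupp.single i (n - j)) (n.choose j : k)) := by
      intro i n
      rw [add_comm, add_pow]
      refine Finset.sum_congr rfl fun j _ => ?_
      rw [← C_mul_X_pow_eq_monomial, ← C_mul_X_pow_eq_monomial]
      simp only [map_mul, map_pow, map_natCast]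
      ring
    have hsum : ∀ x : σ → ℕ, ∑ i, Finsupp.single i (x i) = Finsupp.equivFunOnFinite.symm x := by
      intro x
      ext j
      simp [Finsupp.single_apply]
    have h2 : shiftHom σ k (monomial α c) =
        ∑ x ∈ Fintype.piFinset fun i => Finset.range (α i + 1),
          monomial (Finsupp.equivFunOnFinite.symm x)
            (monomial (Finsupp.equivFunOnFinite.symm fun i => α i - x i)
              (c * ∏ i, ((α i).choose (x i) : k))) := by
      rw [shiftHom, aeval_monomial, Finsupp.prod_fintype _ _ (by simp)]
      simp only [h1]
      rw [Finset.prod_univ_sum, Finset.mul_sum]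
      refine Finset.sum_congr rfl fun x _ => ?_
      rw [prod_monomial_eq, prod_monomial_eq, hsum, hsum]
      rw [IsScalarTower.algebraMap_apply k (MvPolynomial σ k), algebraMap_eq, algebraMap_eq,
        C_mul_monomial, C_mul_monomial]
    rw [h2, coeff_sum, coeff_sum, coeff_monomial]
    simp only [coeff_monomial]
    split_ifs with hα
    · subst hα
      rw [Finset.sum_eq_single (⇑β : σ → ℕ)]
      · rw [if_pos (by simp), coeff_monomial, if_pos (by ext; simp)]
        push_cast
        ring
      · intro x _ hx
        rw [if_neg (fun h => hx (by rw [← h]; simp)), coeff_zero]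
      · intro h
        exact absurd (by simp) h
    · rw [mul_zero]
      refine Finset.sum_eq_zero fun x hx => ?_
      split_ifs with hxβ
      · rw [coeff_monomial, if_neg]
        rintro rfl
        subst hxβ
        refine hα ?_
        ext i
        have := Fintype.mem_piFinset.1 hx i
        rw [Finset.mem_range] at this
        simp
        omega
      · rw [coeff_zero]

theorem coeff_map_C (f : MvPolynomial σ k) (β γ : σ →₀ ℕ) [Decidable (γ = 0)] :
    coeff γ (coeff β (MvPolynomial.map (C : k →+* MvPolynomial σ k) f)) =
      if γ = 0 then coeff β f else 0 := by
  classical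
  rw [coeff_map, coeff_C]
  simp [eq_comm]

theorem choose_pow_mul_modEq {p : ℕ} [Fact p.Prime] (v s : ℕ) :
    (p ^ v * s).choose (p ^ v) ≡ s [MOD p] := by
  induction v with
  | zero => simp [Nat.ModEq]
  | succ v ih =>
    have hp := (Fact.out : p.Prime).pos
    refine (Choose.choose_modEq_choose_mod_mul_choose_div_nat).trans ?_
    rw [pow_succ', mul_assoc, Nat.mul_mod_right, Nat.mul_mod_right, Nat.mul_div_cancel_left _ hp,
      Nat.mul_div_cancel_left _ hp]
    simpa using ih

/-- Polynomials all of whose monomials are `p`-power powers of variables. -/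
def IsAdditivePoly (p : ℕ) (f : MvPolynomial σ k) : Prop :=
  ∀ α, coeff α f ≠ 0 → ∃ i e, α = Finsupp.single i (p ^ e)

variable {p : ℕ} [Fact p.Prime] [CharP k p]

theorem IsAdditivePoly.shiftHom_eq {f : MvPolynomial σ k} (hf : IsAdditivePoly p f) :
    shiftHom σ k f = C f + map C f := by
  have h : ∀ α ∈ f.support, shiftHom σ k (monomial α (coeff α f)) =
      C (monomial α (coeff α f)) + map C (monomial α (coeff α f)) := by
    intro α hα
    obtain ⟨i, e, rfl⟩ := hf α (mem_support_iff.1 hα)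
    rw [← C_mul_X_pow_eq_monomial]
    simp [shiftHom, add_pow_char_pow, mul_add]
  rw [as_sum f, map_sum, map_sum, map_sum, Finset.sum_congr rfl h, Finset.sum_add_distrib]

theorem isAdditivePoly_of_shiftHom_eq [Finite σ] {f : MvPolynomial σ k}
    (hf : shiftHom σ k f = C f + map C f) : IsAdditivePoly p f := by
  classical
  have := Fintype.ofFinite σ
  have key : ∀ β γ, coeff (β + γ) f ≠ 0 → β ≠ 0 → γ ≠ 0 →
      ((∏ i, ((β + γ) i).choose (β i) : ℕ) : k) = 0 := by
    intro β γ h hβ hγ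
    have h1 := coeff_coeff_shiftHom f β γ
    rw [hf, coeff_add, coeff_add, coeff_map_C, if_neg hγ, add_zero, coeff_C, if_neg hβ.symm,
      coeff_zero] at h1
    exact (mul_eq_zero.1 h1.symm).resolve_right h
  have h0 : coeff 0 f = 0 := by
    have h1 := coeff_coeff_shiftHom f 0 0
    rw [hf, coeff_add, coeff_add, coeff_map_C, if_pos rfl, coeff_C, if_pos rfl] at h1
    simpa using h1
  intro α hα
  have hα0 : α ≠ 0 := by rintro rfl; exact hα h0
  obtain ⟨i, hi⟩ : ∃ i, α i ≠ 0 := by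
    by_contra! h
    exact hα0 (Finsupp.ext h)
  have hsingle : α = Finsupp.single i (α i) := by
    by_contra hne
    have hle : Finsupp.single i (α i) ≤ α := by
      simp
    have h1 : Finsupp.single i (α i) + (α - Finsupp.single i (α i)) = α := add_tsub_cancel_of_le hle
    have h2 := key (Finsupp.single i (α i)) (α - Finsupp.single i (α i)) (by rwa [h1])
      (by simpa using hi) (fun h => hne (by rw [h, add_zero] at h1; exact h1.symm))
    rw [h1, Finset.prod_eq_one, Nat.cast_one] at h2
    · exact one_ne_zero h2
    · intro j _
      rcases eq_or_ne j i with rfl | hj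
      · simp
      · simp [hj.symm]
  obtain ⟨v, s, hs, hvs⟩ := Nat.exists_eq_pow_mul_and_not_dvd hi p (Fact.out : p.Prime).ne_one
  refine ⟨i, v, ?_⟩
  rcases eq_or_ne s 1 with rfl | hs1
  · rw [hsingle, hvs, mul_one]
  exfalso
  have hs0 : s ≠ 0 := by rintro rfl; exact hs (dvd_zero p)
  have hp := pow_pos (Fact.out : p.Prime).pos v
  have h1 : Finsupp.single i (p ^ v) + Finsupp.single i (p ^ v * (s - 1)) = α := by
    rw [hsingle, hvs, ← Finsupp.single_add]
    congr 1
    obtain ⟨t, rfl⟩ := Nat.exists_eq_succ_of_ne_zero hs0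
    simp; ring
  have h2 := key (Finsupp.single i (p ^ v)) (Finsupp.single i (p ^ v * (s - 1))) (by rwa [h1])
    (by simpa using hp.ne')
    (Finsupp.single_ne_zero.2 (mul_ne_zero hp.ne' (by omega)))
  rw [h1, Finset.prod_eq_single i, hvs, Finsupp.single_eq_same, CharP.cast_eq_zero_iff k p] at h2
  · exact hs ((choose_pow_mul_modEq v s).dvd_iff dvd_rfl |>.1 h2)
  · intro j _ hj
    simp [hj]
  · simp

end Shift

section AdditiveIdeal

open MonomialOrder

variable {σ k : Type*} [Field k] {m : MonomialOrder σ}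

theorem LeadsWith.degree_eq {f : MvPolynomial σ k} {α : σ →₀ ℕ} (hf : LeadsWith m f α) :
    m.degree f = α :=
  m.toSyn.injective (le_antisymm hf.2
    (m.le_degree (mem_support_iff.2 (by rw [hf.1]; exact one_ne_zero))))

/-- The ideal of `k[x, y]` generated by the `a i (x)` and the `a i (y)`. -/
noncomputable def doubledIdeal (a : σ → MvPolynomial σ k) :
    Ideal (MvPolynomial σ (MvPolynomial σ k)) :=
  (Ideal.span (Set.range a)).map C ⊔ (Ideal.span (Set.range a)).map (map C)

variable {p : ℕ} [Fact p.Prime] [CharP k p]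

theorem shiftHom_mem_doubledIdeal {a : σ → MvPolynomial σ k} (ha : ∀ i, IsAdditivePoly p (a i))
    {f : MvPolynomial σ k} (hf : f ∈ Ideal.span (Set.range a)) :
    shiftHom σ k f ∈ doubledIdeal a := by
  suffices Ideal.span (Set.range a) ≤ (doubledIdeal a).comap (shiftHom σ k) from this hf
  rw [Ideal.span_le]
  rintro _ ⟨i, rfl⟩
  change shiftHom σ k (a i) ∈ doubledIdeal a
  have hi : a i ∈ Ideal.span (Set.range a) := Ideal.subset_span ⟨i, rfl⟩
  rw [(ha i).shiftHom_eq]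
  exact add_mem (Ideal.mem_sup_left (Ideal.mem_map_of_mem _ hi))
    (Ideal.mem_sup_right (Ideal.mem_map_of_mem _ hi))

theorem eq_zero_of_mem_doubledIdeal_of_reduced [Finite σ] {a : σ → MvPolynomial σ k} {q : σ → ℕ}
    (hq : ∀ i, 0 < q i) (ha : ∀ i, LeadsWith m (a i) (Finsupp.single i (q i)))
    {h : MvPolynomial σ (MvPolynomial σ k)} (hh : h ∈ doubledIdeal a)
    (hred : ∀ β γ, coeff γ (coeff β h) ≠ 0 → ∀ i, β i < q i ∧ γ i < q i) : h = 0 := by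
  set I := Ideal.span (Set.range a) with hI
  set φ := Ideal.Quotient.mk I
  have h1 : MvPolynomial.map φ h ∈ Ideal.span (Set.range fun i => map (φ.comp C) (a i)) := by
    suffices doubledIdeal a ≤ (Ideal.span (Set.range fun i => map (φ.comp C) (a i))).comap
      (MvPolynomial.map φ) from this hh
    rw [doubledIdeal, sup_le_iff, Ideal.map_le_iff_le_comap, Ideal.map_le_iff_le_comap]
    constructor
    · intro s hs
      rw [Ideal.mem_comap, Ideal.mem_comap, map_C, Ideal.Quotient.eq_zero_iff_mem.2 hs, C_0]
      exact zero_mem _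
    · rw [Ideal.span_le]
      rintro _ ⟨i, rfl⟩
      refine Ideal.subset_span ⟨i, ?_⟩
      simp [map_map]
  have h2 : MvPolynomial.map φ h = 0 := by
    refine eq_zero_of_mem_span_of_reduced hq (fun i => (ha i).map _) h1 fun β hβ i => ?_
    obtain ⟨γ, hγ⟩ : ∃ γ, coeff γ (coeff β h) ≠ 0 := by
      by_contra! h3
      have h4 : coeff β h = 0 := MvPolynomial.ext _ _ h3
      rw [coeff_map, h4, map_zero] at hβ
      exact hβ rfl
    exact (hred β γ hγ i).1
  ext1 β
  rw [coeff_zero]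
  refine eq_zero_of_mem_span_of_reduced hq ha ?_ fun γ hγ i => (hred β γ hγ i).2
  rw [← Ideal.Quotient.eq_zero_iff_mem, ← coeff_map, h2, coeff_zero]

/-- An element of `I` which is additive modulo the ideal generated by minimal additive
polynomials in `I` belongs to that ideal. -/
theorem mem_span_of_shiftHom_sub_mem [Finite σ] {I : Ideal (MvPolynomial σ k)}
    {a : σ → MvPolynomial σ k} {e : σ → ℕ} (haI : ∀ i, a i ∈ I)
    (ha : ∀ i, IsAdditivePoly p (a i))
    (hlead : ∀ i, LeadsWith m (a i) (Finsupp.single i (p ^ e i)))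
    (hmin : ∀ i e', ∀ a' ∈ I, IsAdditivePoly p a' →
      LeadsWith m a' (Finsupp.single i (p ^ e')) → e i ≤ e')
    {f : MvPolynomial σ k} (hfI : f ∈ I)
    (hf : shiftHom σ k f - C f - map C f ∈ doubledIdeal a) :
    f ∈ Ideal.span (Set.range a) := by
  classical
  have := Fintype.ofFinite σ
  have hp := (Fact.out : p.Prime)
  have hle : Ideal.span (Set.range a) ≤ I := by
    rw [Ideal.span_le]
    rintro _ ⟨i, rfl⟩
    exact haI i
  obtain ⟨g, r, hgr, -, hr⟩ := m.div (b := a) (fun i => by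
    rw [leadingCoeff, (hlead i).degree_eq, (hlead i).1]; exact isUnit_one) f
  have hg : Finsupp.linearCombination _ a g ∈ Ideal.span (Set.range a) :=
    (Finsupp.mem_span_range_iff_exists_finsupp).2 ⟨g, by rw [Finsupp.linearCombination_apply]⟩
  set t := Finsupp.linearCombination _ a g with ht
  have hrI : r ∈ I := by
    have : r = f - t := by rw [hgr]; ring
    rw [this]
    exact sub_mem hfI (hle hg)
  have hred : ∀ α, coeff α r ≠ 0 → ∀ i, α i < p ^ e i := by
    intro α hα i
    have := hr α (mem_support_iff.2 hα) i
    rw [(hlead i).degree_eq] at this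
    by_contra! h
    exact this (by simpa using h)
  have hmem : shiftHom σ k r - C r - map C r ∈ doubledIdeal a := by
    have h1 : shiftHom σ k r - C r - map C r = (shiftHom σ k f - C f - map C f) -
        (shiftHom σ k t - C t - map C t) := by
      rw [hgr, map_add, map_add, map_add]
      ring
    rw [h1]
    exact sub_mem hf (sub_mem (sub_mem (shiftHom_mem_doubledIdeal ha hg)
      (Ideal.mem_sup_left (Ideal.mem_map_of_mem _ hg)))
      (Ideal.mem_sup_right (Ideal.mem_map_of_mem _ hg)))
  have hzero := eq_zero_of_mem_doubledIdeal_of_reduced (fun i => pow_pos hp.pos (e i)) hlead hmem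
    (fun β γ hβγ i => by
      have hsum : coeff (β + γ) r ≠ 0 := by
        intro h0
        apply hβγ
        rw [coeff_sub, coeff_sub, coeff_sub, coeff_sub, coeff_coeff_shiftHom, h0, coeff_map_C,
          coeff_C]
        rcases eq_or_ne β 0 with rfl | hβ
        · rw [zero_add] at h0
          rcases eq_or_ne γ 0 with rfl | hγ
          · simp [h0]
          · simp [h0, hγ]
        · rcases eq_or_ne γ 0 with rfl | hγ
          · rw [add_zero] at h0
            simp [h0, hβ.symm]
          · simp [hγ, hβ.symm]
      have := hred _ hsum i
      rw [Finsupp.add_apply] at this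
      omega)
  have hradd : IsAdditivePoly p r := isAdditivePoly_of_shiftHom_eq (by
    rw [sub_sub, sub_eq_zero] at hzero
    exact hzero)
  suffices r = 0 by rwa [hgr, this, add_zero]
  by_contra hr0
  have hdeg := m.degree_mem_support hr0
  rw [mem_support_iff] at hdeg
  obtain ⟨i, e', hie⟩ := hradd _ hdeg
  have h1 := hmin i e' ((coeff (m.degree r) r)⁻¹ • r) (by
      rw [smul_eq_C_mul]
      exact Ideal.mul_mem_left _ _ hrI)
    (fun α hα => hradd α (by
      rw [coeff_smul, smul_eq_mul] at hα
      exact right_ne_zero_of_mul hα))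
    ⟨by rw [← hie, coeff_smul, smul_eq_mul, inv_mul_cancel₀ hdeg],
      by rw [← hie]; exact m.degree_smul_le⟩
  have h2 := hred _ hdeg i
  rw [hie, Finsupp.single_eq_same] at h2
  exact absurd (Nat.pow_le_pow_right hp.pos h1) (not_le.2 h2)

end AdditiveIdeal

section PartialShift

variable {σ k : Type*} [Field k]

/-- Total homogeneity for polynomials in `y` whose coefficients are polynomials in `x`. -/
def IsBihomogeneous (P : MvPolynomial σ (MvPolynomial σ k)) (d : ℕ) : Prop :=
  ∀ β γ, coeff γ (coeff β P) ≠ 0 → β.degree + γ.degree = d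

theorem IsBihomogeneous.add {P Q : MvPolynomial σ (MvPolynomial σ k)} {d : ℕ}
    (hP : IsBihomogeneous P d) (hQ : IsBihomogeneous Q d) : IsBihomogeneous (P + Q) d := by
  intro β γ h
  by_contra hne
  have h1 : coeff γ (coeff β P) = 0 := by_contra fun h => hne (hP β γ h)
  have h2 : coeff γ (coeff β Q) = 0 := by_contra fun h => hne (hQ β γ h)
  exact h (by rw [coeff_add, coeff_add, h1, h2, add_zero])

theorem IsBihomogeneous.sum {ι : Type*} (s : Finset ι)
    {P : ι → MvPolynomial σ (MvPolynomial σ k)} {d : ℕ}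
    (hP : ∀ i ∈ s, IsBihomogeneous (P i) d) : IsBihomogeneous (∑ i ∈ s, P i) d := by
  classical
  induction s using Finset.induction_on with
  | empty => intro β γ h; simp at h
  | insert i s hi ih =>
    rw [Finset.sum_insert hi]
    exact (hP i (Finset.mem_insert_self i s)).add
      (ih fun j hj => hP j (Finset.mem_insert_of_mem hj))

theorem IsBihomogeneous.mul {P Q : MvPolynomial σ (MvPolynomial σ k)} {d e : ℕ}
    (hP : IsBihomogeneous P d) (hQ : IsBihomogeneous Q e) : IsBihomogeneous (P * Q) (d + e) := by
  classical
  intro β γ h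
  rw [coeff_mul, coeff_sum] at h
  obtain ⟨⟨β₁, β₂⟩, hβ, h⟩ := Finset.exists_ne_zero_of_sum_ne_zero h
  rw [coeff_mul] at h
  obtain ⟨⟨γ₁, γ₂⟩, hγ, h⟩ := Finset.exists_ne_zero_of_sum_ne_zero h
  have h1 := hP _ _ (left_ne_zero_of_mul h)
  have h2 := hQ _ _ (right_ne_zero_of_mul h)
  rw [Finset.HasAntidiagonal.mem_antidiagonal] at hβ hγ
  dsimp only at hβ hγ h1 h2
  rw [← hβ, ← hγ, map_add, map_add]
  omega

theorem IsBihomogeneous.C_C (c : k) :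
    IsBihomogeneous (C (C c) : MvPolynomial σ (MvPolynomial σ k)) 0 := by
  classical
  intro β γ h
  rw [coeff_C] at h
  split_ifs at h with hβ
  · rw [coeff_C] at h
    split_ifs at h with hγ
    · subst hβ hγ; simp
    · exact absurd rfl h
  · exact absurd (coeff_zero _) h

theorem IsBihomogeneous.pow {P : MvPolynomial σ (MvPolynomial σ k)} {d : ℕ}
    (hP : IsBihomogeneous P d) (n : ℕ) : IsBihomogeneous (P ^ n) (n * d) := by
  induction n with
  | zero => simpa using IsBihomogeneous.C_C (σ := σ) (1 : k)
  | succ n ih => rw [pow_succ, add_mul, one_mul]; exact ih.mul hP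

theorem IsBihomogeneous.prod {ι : Type*} (s : Finset ι)
    {P : ι → MvPolynomial σ (MvPolynomial σ k)} {d : ι → ℕ}
    (hP : ∀ i ∈ s, IsBihomogeneous (P i) (d i)) :
    IsBihomogeneous (∏ i ∈ s, P i) (∑ i ∈ s, d i) := by
  classical
  induction s using Finset.induction_on with
  | empty => simpa using IsBihomogeneous.C_C (σ := σ) (1 : k)
  | insert i s hi ih =>
    rw [Finset.prod_insert hi, Finset.sum_insert hi]
    exact (hP i (Finset.mem_insert_self i s)).mul
      (ih fun j hj => hP j (Finset.mem_insert_of_mem hj))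

theorem IsBihomogeneous.isHomogeneous_coeff {P : MvPolynomial σ (MvPolynomial σ k)} {d : ℕ}
    (hP : IsBihomogeneous P d) {β : σ →₀ ℕ} (hβ : β.degree ≤ d) :
    (coeff β P).IsHomogeneous (d - β.degree) := by
  intro γ hγ
  have := hP β γ hγ
  rw [show (Finsupp.weight 1) γ = γ.degree from
    (DFunLike.congr_fun (Finsupp.degree_eq_weight_one (R := ℕ)) γ).symm]
  omega

/-- The substitution `x i ↦ x i + v i (y)`. -/
noncomputable def partialShift (v : σ → MvPolynomial σ k) :
    MvPolynomial σ k →ₐ[k] MvPolynomial σ (MvPolynomial σ k) :=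
  aeval fun i => C (X i) + map C (v i)

theorem isBihomogeneous_C {f : MvPolynomial σ k} {d : ℕ} (hf : f.IsHomogeneous d) :
    IsBihomogeneous (C f : MvPolynomial σ (MvPolynomial σ k)) d := by
  classical
  intro β γ h
  rw [coeff_C] at h
  split_ifs at h with hβ
  · subst hβ
    rw [map_zero, zero_add]
    exact by_contra fun hne => h (hf.coeff_eq_zero hne)
  · exact absurd (coeff_zero _) h

theorem isBihomogeneous_map_C {f : MvPolynomial σ k} {d : ℕ} (hf : f.IsHomogeneous d) :
    IsBihomogeneous (map C f : MvPolynomial σ (MvPolynomial σ k)) d := by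
  classical
  intro β γ h
  rw [coeff_map_C] at h
  split_ifs at h with hγ
  · subst hγ
    rw [map_zero, add_zero]
    exact by_contra fun hne => h (hf.coeff_eq_zero hne)
  · exact absurd rfl h

theorem isBihomogeneous_partialShift {v : σ → MvPolynomial σ k} (hv : ∀ i, (v i).IsHomogeneous 1)
    {f : MvPolynomial σ k} {d : ℕ} (hf : f.IsHomogeneous d) :
    IsBihomogeneous (partialShift v f) d := by
  rw [as_sum f, map_sum]
  refine IsBihomogeneous.sum _ fun α hα => ?_
  rw [partialShift, aeval_monomial]
  have h1 : d = 0 + ∑ i ∈ α.support, α i * 1 := by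
    have := by_contra fun hne => mem_support_iff.1 hα (hf.coeff_eq_zero (d := α) hne)
    rw [← this, zero_add, Finsupp.degree_apply]
    simp
  rw [h1]
  refine (IsBihomogeneous.C_C _).mul (IsBihomogeneous.prod _ fun i _ => IsBihomogeneous.pow ?_ _)
  exact (isBihomogeneous_C (isHomogeneous_X _ _)).add (isBihomogeneous_map_C (hv i))

@[simp]
theorem partialShift_C (v : σ → MvPolynomial σ k) (c : k) : partialShift v (C c) = C (C c) := by
  rw [partialShift, aeval_C]
  rfl

@[simp]
theorem partialShift_X (v : σ → MvPolynomial σ k) (i : σ) :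
    partialShift v (X i) = C (X i) + map C (v i) := by
  rw [partialShift, aeval_X]

theorem coeff_zero_partialShift {v : σ → MvPolynomial σ k} (hv : ∀ i, (v i).IsHomogeneous 1)
    (f : MvPolynomial σ k) : coeff 0 (partialShift v f) = f := by
  rw [← constantCoeff_eq]
  induction f using MvPolynomial.induction_on with
  | C c => simp
  | add f g hf hg => rw [map_add, map_add, hf, hg]
  | mul_X f i hf =>
    have h0 : constantCoeff (v i) = 0 := (hv i).coeff_eq_zero (by simp)
    rw [map_mul, map_mul, hf, partialShift_X, map_add, constantCoeff_C, constantCoeff_map, h0,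
      C_0, add_zero]

theorem map_constantCoeff_partialShift (v : σ → MvPolynomial σ k) (f : MvPolynomial σ k) :
    map constantCoeff (partialShift v f) = aeval v f := by
  induction f using MvPolynomial.induction_on with
  | C c => simp
  | add f g hf hg => rw [map_add, map_add, map_add, hf, hg]
  | mul_X f i hf =>
    have h0 : (constantCoeff : MvPolynomial σ k →+* k).comp C = RingHom.id k := by ext; simp
    rw [map_mul, map_mul, map_mul, hf, partialShift_X, map_add, map_C, constantCoeff_X, C_0,
      zero_add, map_map, h0, map_id, aeval_X]

theorem smul_coeff_partialShift {Γ : Type*} [CommGroup Γ] [MulSemiringAction Γ (MvPolynomial σ k)]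
    (hlin : IsLinearAction Γ σ k) {v : σ → MvPolynomial σ k} {g : Γ}
    (hv : ∀ i, partialShift v (g • (X i : MvPolynomial σ k) - X i) = C (g • X i - X i))
    (f : MvPolynomial σ k) (β : σ →₀ ℕ) :
    g • coeff β (partialShift v f) = coeff β (partialShift v (g • f)) := by
  set φ := MulSemiringAction.toRingHom Γ (MvPolynomial σ k) g with hφ
  have hφC : φ.comp C = C := by ext1 c; exact hlin.smul_C g c
  suffices h : map φ (partialShift v f) = partialShift v (g • f) by
    rw [← h, coeff_map]
    rfl
  induction f using MvPolynomial.induction_on with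
  | C c =>
    rw [hlin.smul_C, partialShift_C, map_C]
    exact congrArg C (hlin.smul_C g c)
  | add f g hf hg => rw [map_add, map_add, smul_add, map_add, hf, hg]
  | mul_X f i hf =>
    have h1 : partialShift v (g • X i) = C (g • X i) + map C (v i) := by
      rw [← sub_add_cancel (g • (X i : MvPolynomial σ k)) (X i), map_add, hv, partialShift_X, map_add]
      ring
    rw [map_mul, map_mul, smul_mul', map_mul, hf, h1, partialShift_X, map_add, map_C, map_map, hφC]
    rfl

end PartialShift

section HilbertIdeal

variable {Γ σ k : Type*} [Field k] [CommGroup Γ] [MulSemiringAction Γ (MvPolynomial σ k)]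

/-- The homogeneous invariants of positive degree. -/
def positiveInvariants (Γ σ k : Type*) [Field k] [CommGroup Γ]
    [MulSemiringAction Γ (MvPolynomial σ k)] : Set (MvPolynomial σ k) :=
  {f | (∀ g : Γ, g • f = f) ∧ ∃ d, 0 < d ∧ f.IsHomogeneous d}

theorem isAdditivePoly_of_isHomogeneous_one (p : ℕ) {f : MvPolynomial σ k}
    (hf : f.IsHomogeneous 1) : IsAdditivePoly p f := by
  intro α hα
  have h1 : α.degree = 1 := by_contra fun h => hα (hf.coeff_eq_zero h)
  obtain ⟨i, hi⟩ : α ∈ Set.range fun i : σ => Finsupp.single i 1 := by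
    rw [Finsupp.range_single_one]
    exact h1
  exact ⟨i, 0, by simpa using hi.symm⟩

theorem exists_X_pow_mem_span_positiveInvariants [Fintype Γ] (hlin : IsLinearAction Γ σ k)
    {p : ℕ} (hΓ : IsPGroup p Γ) [Fact p.Prime] (i : σ)
    (hU : ∀ g : Γ, g • (X i : MvPolynomial σ k) - X i ∈ positiveInvariants Γ σ k) :
    ∃ e, (X i : MvPolynomial σ k) ^ p ^ e ∈ Ideal.span (positiveInvariants Γ σ k) := by
  obtain ⟨e, he⟩ := hΓ.exists_card_eq
  refine ⟨e, ?_⟩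
  have h1 : ∏ g : Γ, g • (X i : MvPolynomial σ k) ∈ Ideal.span (positiveInvariants Γ σ k) := by
    refine Ideal.subset_span ⟨fun g => ?_, Fintype.card Γ, Fintype.card_pos, ?_⟩
    · simp only [Finset.smul_prod', ← mul_smul]
      exact Fintype.prod_equiv (Equiv.mulLeft g) _ _ fun _ => rfl
    · have := IsHomogeneous.prod Finset.univ (fun g : Γ => g • (X i : MvPolynomial σ k))
        (fun _ => 1) fun g _ => hlin.smul_X g i
      simpa using this
  rw [← Ideal.Quotient.eq_zero_iff_mem] at h1 ⊢
  rw [← he, Nat.card_eq_fintype_card, ← Finset.card_univ, map_pow, ← Finset.prod_const, ← h1,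
    map_prod]
  refine Finset.prod_congr rfl fun g _ => ?_
  rw [eq_comm, Ideal.Quotient.eq]
  exact Ideal.subset_span (hU g)

theorem partialShift_of_isHomogeneous_one {P : MvPolynomial σ k →ₗ[k] MvPolynomial σ k}
    {f : MvPolynomial σ k} (hf : f.IsHomogeneous 1) :
    partialShift (fun i => X i - P (X i)) f = C f + map C (f - P f) := by
  rw [← mem_homogeneousSubmodule, homogeneousSubmodule_one_eq_span_X] at hf
  induction hf using Submodule.span_induction with
  | mem f hf =>
    obtain ⟨i, rfl⟩ := hf
    rw [partialShift_X]
  | zero => simp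
  | add f g _ _ hf hg =>
    rw [map_add, hf, hg]
    simp only [map_add, map_sub]
    ring
  | smul c f _ hf =>
    rw [map_smul, hf, LinearMap.map_smul, ← smul_sub, smul_eq_C_mul, smul_eq_C_mul, map_mul, map_mul,
      map_C, ← mul_add]
    exact Algebra.smul_def c _

theorem sub_aeval_mem {τ B : Type*} [CommRing B] [Algebra k B] {K : Ideal B} {u v : τ → B}
    (h : ∀ i, u i - v i ∈ K) (f : MvPolynomial τ k) : aeval u f - aeval v f ∈ K := by
  rw [← Ideal.Quotient.eq]
  induction f using MvPolynomial.induction_on with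
  | C c => simp
  | add f g hf hg => simp only [map_add, hf, hg]
  | mul_X f i hf =>
    simp only [map_mul, hf, aeval_X]
    rw [(Ideal.Quotient.eq).2 (h i)]

variable {p : ℕ} [Fact p.Prime] [CharP k p]

/-- If every group element moves the variables by invariants, then the Hilbert ideal is generated
by as many elements as there are variables. -/
theorem exists_span_positiveInvariants_eq [Finite σ] (m : MonomialOrder σ) [Fintype Γ]
    (hlin : IsLinearAction Γ σ k) (hΓ : IsPGroup p Γ)
    (hW : ∀ (g h : Γ) (i : σ), h • (g • (X i : MvPolynomial σ k) - X i) = g • X i - X i) :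
    ∃ a : σ → MvPolynomial σ k,
      Ideal.span (positiveInvariants Γ σ k) = Ideal.span (Set.range a) := by
  classical
  set I := Ideal.span (positiveInvariants Γ σ k) with hI
  have hhom : ∀ (g : Γ) (i : σ), (g • (X i : MvPolynomial σ k) - X i).IsHomogeneous 1 :=
    fun g i => (hlin.smul_X g i).sub (isHomogeneous_X _ _)
  have hU : ∀ (g : Γ) (i : σ), g • (X i : MvPolynomial σ k) - X i ∈ positiveInvariants Γ σ k :=
    fun g i => ⟨fun h => hW g h i, 1, one_pos, hhom g i⟩
  have hex : ∀ i, ∃ e, ∃ a ∈ I, IsAdditivePoly p a ∧ LeadsWith m a (Finsupp.single i (p ^ e)) := by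
    intro i
    obtain ⟨e, he⟩ := exists_X_pow_mem_span_positiveInvariants hlin hΓ i fun g => hU g i
    refine ⟨e, _, he, ?_, ?_⟩
    · intro α hα
      rw [coeff_X_pow] at hα
      exact ⟨i, e, by_contra fun h => hα (if_neg (Ne.symm h))⟩
    · rw [X_pow_eq_monomial]
      exact LeadsWith.monomial _
  let e : σ → ℕ := fun i => Nat.find (hex i)
  choose a haI ha hlead using fun i => Nat.find_spec (hex i)
  have hmin : ∀ i e', ∀ a' ∈ I, IsAdditivePoly p a' →
      LeadsWith m a' (Finsupp.single i (p ^ e')) → e i ≤ e' :=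
    fun i e' a' h1 h2 h3 => Nat.find_min' (hex i) ⟨a', h1, h2, h3⟩
  have lemM : ∀ f ∈ I, shiftHom σ k f - C f - map C f ∈ doubledIdeal a →
      f ∈ Ideal.span (Set.range a) :=
    fun f hf h => mem_span_of_shiftHom_sub_mem (e := e) haI ha hlead hmin hf h
  refine ⟨a, le_antisymm ?_ ?_⟩
  swap
  · rw [Ideal.span_le]
    rintro _ ⟨i, rfl⟩
    exact haI i
  let U : Submodule k (MvPolynomial σ k) :=
    Submodule.span k (Set.range fun x : Γ × σ => x.1 • (X x.2 : MvPolynomial σ k) - X x.2)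
  have hUhom : ∀ u ∈ U, u.IsHomogeneous 1 := by
    intro u hu
    rw [← mem_homogeneousSubmodule]
    refine (Submodule.span_le.2 ?_ : U ≤ _) hu
    rintro _ ⟨x, rfl⟩
    exact hhom x.1 x.2
  have hUa : ∀ u ∈ U, u ∈ Ideal.span (Set.range a) := by
    intro u hu
    refine (Submodule.span_le.2 ?_ : U ≤ (Ideal.span (Set.range a)).restrictScalars k) hu
    rintro _ ⟨x, rfl⟩
    refine lemM _ (Ideal.subset_span (hU x.1 x.2)) ?_
    rw [(isAdditivePoly_of_isHomogeneous_one p (hhom x.1 x.2)).shiftHom_eq]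
    simp
  obtain ⟨P₀, hP₀⟩ := U.subtype.exists_leftInverse_of_injective (Submodule.ker_subtype U)
  let P : MvPolynomial σ k →ₗ[k] MvPolynomial σ k := U.subtype ∘ₗ P₀
  have hPmem : ∀ f, P f ∈ U := fun f => (P₀ f).2
  have hPU : ∀ u ∈ U, P u = u := fun u hu =>
    congrArg Subtype.val (LinearMap.congr_fun hP₀ ⟨u, hu⟩)
  let v : σ → MvPolynomial σ k := fun i => X i - P (X i)
  have hv : ∀ i, (v i).IsHomogeneous 1 := fun i => (isHomogeneous_X _ _).sub (hUhom _ (hPmem _))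
  have hvU : ∀ (g : Γ) (i : σ),
      partialShift v (g • (X i : MvPolynomial σ k) - X i) = C (g • X i - X i) := by
    intro g i
    rw [partialShift_of_isHomogeneous_one (hhom g i), hPU _ (Submodule.subset_span ⟨(g, i), rfl⟩),
      sub_self, map_zero, add_zero]
  rw [hI, Ideal.span_le]
  rintro f ⟨hf, d, hd, hfd⟩
  induction d using Nat.strong_induction_on generalizing f with
  | _ d ih =>
    refine lemM f (Ideal.subset_span ⟨hf, d, hd, hfd⟩) ?_
    have hbi := isBihomogeneous_partialShift hv hfd
    have hLd : (aeval v f).IsHomogeneous d := by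
      simpa using hfd.aeval v hv
    have h1 : shiftHom σ k f - partialShift v f ∈ doubledIdeal a := by
      refine sub_aeval_mem (fun i => ?_) f
      have : C (X i) + X i - (C (X i) + map C (v i)) =
          (map C (P (X i)) : MvPolynomial σ (MvPolynomial σ k)) := by
        simp only [v, map_sub, map_X]
        ring
      rw [this]
      exact Ideal.mem_sup_right (Ideal.mem_map_of_mem _ (hUa _ (hPmem _)))
    have h2 : map C (aeval v f) - map C f ∈ doubledIdeal a := by
      rw [← map_sub]
      refine Ideal.mem_sup_right (Ideal.mem_map_of_mem _ ?_)
      have := sub_aeval_mem (K := Ideal.span (Set.range a)) (u := v) (v := X) (fun i => by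
        have : v i - X i = - P (X i) := by simp [v]
        rw [this]
        exact neg_mem (hUa _ (hPmem _))) f
      simpa using this
    have h3 : partialShift v f - C f - map C (aeval v f) ∈ doubledIdeal a := by
      refine Ideal.mem_sup_left (mem_map_C_iff.2 fun β => ?_)
      rw [coeff_sub, coeff_sub]
      rcases eq_or_ne β 0 with rfl | hβ
      · rw [coeff_zero_partialShift hv, coeff_zero_C, coeff_map,
          hLd.coeff_eq_zero (by simpa using hd.ne), C_0]
        simp
      rw [coeff_C, if_neg hβ.symm, sub_zero]
      have hβ0 : 0 < β.degree := by
        rw [Nat.pos_iff_ne_zero, Ne, Finsupp.degree_eq_zero_iff]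
        exact hβ
      rcases lt_or_ge β.degree d with hlt | hge
      · rw [coeff_map, hLd.coeff_eq_zero hlt.ne, C_0, sub_zero]
        refine ih (d - β.degree) (by omega) ?_ (by omega) (hbi.isHomogeneous_coeff hlt.le)
        intro g
        rw [smul_coeff_partialShift hlin (hvU g), hf]
      · suffices h : coeff β (partialShift v f) - coeff β (map C (aeval v f)) = 0 by
          rw [h]
          exact zero_mem _
        ext γ
        rw [coeff_sub, coeff_map_C, ← map_constantCoeff_partialShift, coeff_map, constantCoeff_eq,
          coeff_zero]
        split_ifs with hγ
        · rw [hγ, sub_self]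
        · rw [sub_zero]
          by_contra hne
          have := hbi β γ hne
          have : γ.degree ≠ 0 := fun h => hγ ((Finsupp.degree_eq_zero_iff γ).1 h)
          omega
    have : shiftHom σ k f - C f - map C f = (shiftHom σ k f - partialShift v f) +
        (partialShift v f - C f - map C (aeval v f)) + (map C (aeval v f) - map C f) := by ring
    rw [this]
    exact add_mem (add_mem h1 h3) h2

end HilbertIdeal

section GradedNakayama

variable {σ k : Type*} [Field k]

theorem homogeneousComponent_add_mul (d e : ℕ) (s : MvPolynomial σ k) {h : MvPolynomial σ k}
    (hh : h.IsHomogeneous e) :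
    homogeneousComponent (d + e) (s * h) = homogeneousComponent d s * h := by
  induction s using MvPolynomial.induction_on' with
  | monomial α c =>
    have h1 : (monomial α c : MvPolynomial σ k) ∈ homogeneousSubmodule σ k α.degree :=
      isHomogeneous_monomial c rfl
    have h2 : monomial α c * h ∈ homogeneousSubmodule σ k (α.degree + e) :=
      (isHomogeneous_monomial c rfl).mul hh
    rw [homogeneousComponent_of_mem h1, homogeneousComponent_of_mem h2]
    by_cases hd : d = α.degree
    · simp [hd]
    · simp [hd]
  | add a b ha hb => rw [add_mul, map_add, ha, hb, map_add, add_mul]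

theorem homogeneousComponent_mul_of_lt {d e : ℕ} (hde : d < e) (s : MvPolynomial σ k)
    {h : MvPolynomial σ k} (hh : h.IsHomogeneous e) : homogeneousComponent d (s * h) = 0 := by
  induction s using MvPolynomial.induction_on' with
  | monomial α c =>
    have h2 : monomial α c * h ∈ homogeneousSubmodule σ k (α.degree + e) :=
      (isHomogeneous_monomial c rfl).mul hh
    rw [homogeneousComponent_of_mem h2, if_neg (by omega)]
  | add a b ha hb => rw [add_mul, map_add, ha, hb, add_zero]

/-- Graded Nakayama: a set of homogeneous elements of positive degree generating an ideal modulo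
its product with the irrelevant ideal generates the ideal. -/
theorem subset_span_of_subset_span_sup {H T : Set (MvPolynomial σ k)}
    (hH : ∀ h ∈ H, ∃ d, 0 < d ∧ h.IsHomogeneous d) (hTH : T ⊆ H)
    (hT : ∀ h ∈ H, h ∈ Submodule.span k T ⊔
      (RingHom.ker (constantCoeff (R := k) (σ := σ)) * Ideal.span H).restrictScalars k) :
    H ⊆ Ideal.span T := by
  intro x hx
  obtain ⟨d, hd, hxd⟩ := hH x hx
  induction d using Nat.strong_induction_on generalizing x with
  | _ d ih =>
    obtain ⟨y, hy, z, hz, rfl⟩ := Submodule.mem_sup.1 (hT x hx)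
    have hcomp : homogeneousComponent d (y + z) = y + z := by
      rw [homogeneousComponent_of_mem hxd, if_pos rfl]
    rw [← hcomp, map_add]
    refine add_mem ?_ ?_
    · clear hcomp hxd hx
      induction hy using Submodule.span_induction with
      | mem t ht =>
        obtain ⟨e, -, hte⟩ := hH t (hTH ht)
        rw [homogeneousComponent_of_mem hte]
        split_ifs
        · exact Ideal.subset_span ht
        · exact zero_mem _
      | zero => simp
      | add a b _ _ ha hb => rw [map_add]; exact add_mem ha hb
      | smul c a _ ha =>
        rw [map_smul, smul_eq_C_mul]
        exact Ideal.mul_mem_left _ _ ha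
    · clear hcomp hxd hx
      refine Submodule.mul_induction_on (Submodule.restrictScalars_mem k _ _ |>.1 hz) ?_ ?_
      · intro m hm h hh
        induction hh using Submodule.span_induction generalizing m with
        | mem h hh =>
          obtain ⟨e, he, hhe⟩ := hH h hh
          rcases lt_trichotomy d e with hlt | rfl | hlt
          · rw [homogeneousComponent_mul_of_lt hlt m hhe]
            exact zero_mem _
          · have := homogeneousComponent_add_mul 0 d m hhe
            rw [zero_add] at this
            rw [this, homogeneousComponent_zero, ← constantCoeff_eq, RingHom.mem_ker.1 hm, C_0,
              zero_mul]
            exact zero_mem _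
          · obtain ⟨j, rfl⟩ := Nat.exists_eq_add_of_le' hlt.le
            rw [homogeneousComponent_add_mul j e m hhe]
            exact Ideal.mul_mem_left _ _ (ih e hlt hh he hhe)
        | zero => simp
        | add a b _ _ ha hb => rw [mul_add, map_add]; exact add_mem (ha m hm) (hb m hm)
        | smul c a _ ha =>
          rw [smul_eq_mul, ← mul_assoc]
          exact ha _ (Ideal.mul_mem_right _ _ hm)
      · intro a b ha hb
        rw [map_add]
        exact add_mem ha hb

/-- If an ideal generated by homogeneous elements of positive degree can be generated by `n`
elements, then `n` of the homogeneous generators suffice. -/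
theorem exists_subset_span_range [Fintype σ] {H : Set (MvPolynomial σ k)}
    (hH : ∀ h ∈ H, ∃ d, 0 < d ∧ h.IsHomogeneous d) (h0 : 0 ∈ H) {a : σ → MvPolynomial σ k}
    (ha : Ideal.span H = Ideal.span (Set.range a)) :
    ∃ f : σ → MvPolynomial σ k, (∀ i, f i ∈ H) ∧ H ⊆ Ideal.span (Set.range f) := by
  classical
  let K : Ideal (MvPolynomial σ k) :=
    RingHom.ker (constantCoeff (R := k) (σ := σ)) * Ideal.span H
  let q : MvPolynomial σ k →ₗ[k] (MvPolynomial σ k ⧸ K.restrictScalars k) :=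
    (K.restrictScalars k).mkQ
  obtain ⟨B, hBH, hBspan, hB⟩ := exists_linearIndependent k (q '' H)
  have hle : Set.range (Subtype.val : B → _) ≤ Submodule.span k (Set.range (q ∘ a)) := by
    rw [Subtype.range_coe]
    refine (hBH.trans ?_)
    rintro _ ⟨h, hh, rfl⟩
    have h1 : h ∈ Ideal.span (Set.range a) := ha ▸ Ideal.subset_span hh
    obtain ⟨c, rfl⟩ := Ideal.mem_span_range_iff_exists_fun.1 h1
    rw [map_sum]
    refine sum_mem fun i _ => ?_
    have h2 : q (c i * a i) = constantCoeff (c i) • q (a i) := by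
      rw [← map_smul, ← sub_eq_zero, ← map_sub, smul_eq_C_mul, ← sub_mul]
      refine (Submodule.Quotient.mk_eq_zero _).2 (Ideal.mul_mem_mul ?_ ?_)
      · simp [RingHom.mem_ker]
      · rw [ha]
        exact Ideal.subset_span ⟨i, rfl⟩
    rw [h2]
    exact Submodule.smul_mem _ _ (Submodule.subset_span ⟨i, rfl⟩)
  have hcard : Cardinal.mk B ≤ Fintype.card σ :=
    (linearIndependent_le_span' _ hB _ hle).trans (by exact_mod_cast Fintype.card_range_le _)
  have : Finite B := Cardinal.lt_aleph0_iff_finite.1 (hcard.trans_lt (Cardinal.natCast_lt_aleph0))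
  have := Fintype.ofFinite B
  obtain ⟨emb⟩ : Nonempty (B ↪ σ) := by
    rw [Cardinal.mk_fintype] at hcard
    exact Function.Embedding.nonempty_of_card_le (by exact_mod_cast hcard)
  choose rep hrepH hrep using fun t : B => hBH t.2
  refine ⟨Function.extend emb rep 0, fun i => ?_, ?_⟩
  · by_cases hi : ∃ t, emb t = i
    · obtain ⟨t, rfl⟩ := hi
      rw [emb.injective.extend_apply]
      exact hrepH t
    · rw [Function.extend_apply' _ _ _ hi]
      exact h0
  · refine (subset_span_of_subset_span_sup (T := Set.range rep) hH ?_ ?_).trans ?_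
    · rintro _ ⟨t, rfl⟩
      exact hrepH t
    · intro h hh
      have h1 : q h ∈ Submodule.map q (Submodule.span k (Set.range rep)) := by
        rw [Submodule.map_span, ← Set.range_comp]
        have : Set.range (q ∘ rep) = B := by
          rw [show (q ∘ rep) = Subtype.val from funext hrep, Subtype.range_coe]
        rw [this, hBspan]
        exact Submodule.subset_span ⟨h, hh, rfl⟩
      rw [← Submodule.mem_comap, Submodule.comap_map_mkQ, sup_comm] at h1
      exact h1
    · refine Ideal.span_mono ?_
      rintro _ ⟨t, rfl⟩
      exact ⟨emb t, emb.injective.extend_apply _ _ _⟩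

end GradedNakayama

section PrincipalTransfer

variable {Γ σ k : Type*} [Field k] [CommGroup Γ] [MulSemiringAction Γ (MvPolynomial σ k)]

/-- If the image of the transfer is principal, then generators of the Hilbert ideal that are
homogeneous invariants of positive degree generate the ring of invariants. -/
theorem mem_adjoin_of_subset_span [Fintype σ] [Fintype Γ] (hlin : IsLinearAction Γ σ k)
    {D b : MvPolynomial σ k} (hb : ∑ g : Γ, g • b = D) (hD : ∀ s, D ∣ ∑ g : Γ, g • s)
    (hD0 : D ≠ 0) {f : σ → MvPolynomial σ k} (hf : ∀ i, f i ∈ positiveInvariants Γ σ k)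
    (hspan : positiveInvariants Γ σ k ⊆ Ideal.span (Set.range f)) {x : MvPolynomial σ k}
    (hx : ∀ g : Γ, g • x = x) : x ∈ Algebra.adjoin k (Set.range f) := by
  have hhom : ∀ (d : ℕ) (x : MvPolynomial σ k), (∀ g : Γ, g • x = x) → x.IsHomogeneous d →
      x ∈ Algebra.adjoin k (Set.range f) := by
    intro d
    induction d using Nat.strong_induction_on with
    | _ d ih =>
      intro x hx hxd
      rcases Nat.eq_zero_or_pos d with rfl | hd
      · rw [← homogeneousComponent_eq_self hxd, homogeneousComponent_zero]
        exact Subalgebra.algebraMap_mem _ _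
      obtain ⟨s, rfl⟩ := Ideal.mem_span_range_iff_exists_fun.1 (hspan ⟨hx, d, hd, hxd⟩)
      choose a ha using fun i => hD (b * s i)
      have hainv : ∀ i (g : Γ), g • a i = a i := by
        intro i g
        have := smul_eq_of_sum_smul_eq (ha i) g
        rw [smul_mul', smul_eq_of_sum_smul_eq hb] at this
        exact mul_left_cancel₀ hD0 this
      have hsum : ∑ i, s i * f i = ∑ i, a i * f i := by
        refine mul_left_cancel₀ hD0 ?_
        calc D * ∑ i, s i * f i = ∑ g : Γ, g • (b * ∑ i, s i * f i) := by
              simp only [smul_mul', hx]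
              rw [← Finset.sum_mul, hb]
          _ = ∑ i, (∑ g : Γ, g • (b * s i)) * f i := by
              simp only [Finset.mul_sum, Finset.smul_sum, Finset.sum_mul]
              rw [Finset.sum_comm]
              refine Finset.sum_congr rfl fun i _ => Finset.sum_congr rfl fun g _ => ?_
              rw [← mul_assoc, smul_mul' g (b * s i), (hf i).1 g]
          _ = D * ∑ i, a i * f i := by
              simp only [ha, Finset.mul_sum, mul_assoc]
      rw [hsum] at hxd ⊢
      rw [← homogeneousComponent_eq_self hxd, map_sum]
      refine sum_mem fun i _ => ?_
      obtain ⟨e, he, hfe⟩ := (hf i).2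
      rcases lt_or_ge d e with hlt | hge
      · rw [homogeneousComponent_mul_of_lt hlt _ hfe]
        exact zero_mem _
      · obtain ⟨j, rfl⟩ := Nat.exists_eq_add_of_le' hge
        rw [homogeneousComponent_add_mul j e _ hfe]
        refine mul_mem (ih j (by omega) _ (fun g => ?_) (homogeneousComponent_isHomogeneous _ _))
          (Algebra.subset_adjoin ⟨i, rfl⟩)
        rw [← hlin.homogeneousComponent_smul, hainv]
  rw [← sum_homogeneousComponent x]
  refine sum_mem fun d _ => hhom d _ (fun g => ?_) (homogeneousComponent_isHomogeneous _ _)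
  rw [← hlin.homogeneousComponent_smul, hx]

/-- As many invariants as there are variables, generating the ring of invariants, are
algebraically independent. -/
theorem algebraicIndependent_of_forall_mem_adjoin [Finite σ] [Finite Γ]
    {f : σ → MvPolynomial σ k}
    (hlin : IsLinearAction Γ σ k) (hf : ∀ i (g : Γ), g • f i = f i)
    (hadj : ∀ x : MvPolynomial σ k, (∀ g : Γ, g • x = x) → x ∈ Algebra.adjoin k (Set.range f)) :
    AlgebraicIndependent k f := by
  let A := Algebra.adjoin k (Set.range f)
  have hA : ∀ (g : Γ), ∀ a ∈ A, g • a = a := by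
    intro g a ha
    induction ha using Algebra.adjoin_induction with
    | mem x hx => obtain ⟨i, rfl⟩ := hx; exact hf i g
    | algebraMap r => exact hlin.smul_C g r
    | add x y _ _ hx hy => rw [smul_add, hx, hy]
    | mul x y _ _ hx hy => rw [smul_mul', hx, hy]
  have : SMulCommClass Γ A (MvPolynomial σ k) :=
    ⟨fun g a x => by rw [Algebra.smul_def, Algebra.smul_def, smul_mul']; congr 1; exact hA g _ a.2⟩
  have : Algebra.IsInvariant A (MvPolynomial σ k) Γ := ⟨fun x hx => ⟨⟨x, hadj x hx⟩, rfl⟩⟩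
  have : Algebra.IsIntegral A (MvPolynomial σ k) :=
    Algebra.IsInvariant.isIntegral A (MvPolynomial σ k) Γ
  refine (Algebra.IsAlgebraic.isTranscendenceBasis_of_lift_le_trdeg_of_finite k f ?_).1
  rw [MvPolynomial.trdeg_of_isDomain]
  simp

variable {p : ℕ} [Fact p.Prime] [CharP k p]

/-- If the image of the transfer of an abelian `p`-group is principal, then the ring of invariants
is a polynomial ring. -/
theorem exists_polynomial_generators [Fintype σ] (m : MonomialOrder σ) [Fintype Γ]
    [FaithfulSMul Γ (MvPolynomial σ k)] (hlin : IsLinearAction Γ σ k) (hΓ : IsPGroup p Γ)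
    {D b : MvPolynomial σ k} (hb : ∑ g : Γ, g • b = D) (hD : ∀ s, D ∣ ∑ g : Γ, g • s) :
    ∃ f : σ → MvPolynomial σ k, (∀ i, f i ∈ positiveInvariants Γ σ k) ∧
      AlgebraicIndependent k f ∧
      ∀ x : MvPolynomial σ k, (∀ g : Γ, g • x = x) → x ∈ Algebra.adjoin k (Set.range f) := by
  have hD0 : D ≠ 0 := by
    rintro rfl
    obtain ⟨s, hs⟩ := exists_sum_smul_ne_zero Γ σ k
    exact hs (zero_dvd_iff.1 (hD s))
  have hW := bireflectionSubgroup_eq_top hlin hΓ hb hD hD0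
  have hW' : ∀ g : Γ, g ∈ bireflectionSubgroup Γ σ k := fun g => hW ▸ Subgroup.mem_top g
  obtain ⟨a, ha⟩ := exists_span_positiveInvariants_eq m hlin hΓ fun g h i => hW' g i h
  obtain ⟨f, hf, hfspan⟩ := exists_subset_span_range (H := positiveInvariants Γ σ k)
    (fun h hh => hh.2) ⟨fun g => smul_zero g, 1, one_pos, isHomogeneous_zero _ _ _⟩ ha
  have hadj : ∀ x : MvPolynomial σ k, (∀ g : Γ, g • x = x) →
      x ∈ Algebra.adjoin k (Set.range f) :=
    fun x hx => mem_adjoin_of_subset_span hlin hb hD hD0 hf hfspan hx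
  exact ⟨f, hf, algebraicIndependent_of_forall_mem_adjoin hlin (fun i => (hf i).1) hadj, hadj⟩

end PrincipalTransfer

section FrobeniusSplitting

theorem exists_addMonoidHom_semilinear {K L : Type*} [Field K] [Field L] (φ : K →+* L) {κ : L}
    (hκ : κ ≠ 0) : ∃ μ : L →+ K, (∀ x y, μ (φ x * y) = x * μ y) ∧ μ κ = 1 := by
  let := φ.toAlgebra
  obtain ⟨F, hF⟩ : ∃ F : Module.Dual K L, F κ ≠ 0 := by
    by_contra! h
    exact hκ ((Module.forall_dual_apply_eq_zero_iff K κ).1 h)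
  refine ⟨((F κ)⁻¹ • F : Module.Dual K L).toAddMonoidHom, fun x y => ?_, ?_⟩
  · have : φ x * y = x • y := (Algebra.smul_def x y).symm
    rw [this]
    exact map_smul ((F κ)⁻¹ • F) x y
  · simp [hF]

variable {τ k : Type*} [Field k]

/-- The additive map sending a polynomial to the polynomial whose coefficient at `δ` is the image
under `μ` of the coefficient at `β + q δ`. -/
theorem exists_addMonoidHom_coeff (μ : k →+ k) (β : τ →₀ ℕ) {q : ℕ} (hq : 0 < q) :
    ∃ ψ : MvPolynomial τ k →+ MvPolynomial τ k,
      ∀ f δ, coeff δ (ψ f) = μ (coeff (β + q • δ) f) := by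
  classical
  have hinj : Function.Injective fun δ : τ →₀ ℕ => β + q • δ := by
    intro δ δ' h
    ext i
    have := DFunLike.congr_fun h i
    simpa [hq.ne'] using this
  let ψ : MvPolynomial τ k → MvPolynomial τ k := fun f =>
    ∑ δ ∈ f.support.preimage (fun δ => β + q • δ) hinj.injOn, monomial δ (μ (coeff (β + q • δ) f))
  have hψ : ∀ f δ, coeff δ (ψ f) = μ (coeff (β + q • δ) f) := by
    intro f δ
    simp only [ψ, coeff_sum, coeff_monomial]
    rw [Finset.sum_ite_eq']
    split_ifs with h
    · rfl
    · rw [Finset.mem_preimage, notMem_support_iff] at h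
      rw [h, map_zero]
  refine ⟨AddMonoidHom.mk' ψ fun f g => ?_, hψ⟩
  ext δ
  simp only [coeff_add, hψ, map_add]

variable (p : ℕ) [Fact p.Prime] [CharP k p]

/-- Up to a Frobenius twist, every nonzero polynomial is mapped to `1` by some linear form. -/
theorem exists_frobenius_splitting [Finite τ] {c : MvPolynomial τ k} (hc : c ≠ 0) :
    ∃ (e : ℕ) (ψ : MvPolynomial τ k →+ MvPolynomial τ k),
      (∀ a b, ψ (a ^ p ^ e * b) = a * ψ b) ∧ ψ c = 1 := by
  classical
  have hp := (Fact.out : p.Prime)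
  obtain ⟨β, hβ⟩ := exists_coeff_ne_zero hc
  set e := c.totalDegree with he
  have hq : e < p ^ e := Nat.lt_pow_self hp.one_lt
  have hsmall : ∀ γ i, coeff γ c ≠ 0 → γ i < p ^ e := by
    intro γ i hγ
    refine lt_of_le_of_lt ?_ hq
    exact (Finsupp.le_degree i γ).trans (le_totalDegree (mem_support_iff.2 hγ))
  set q := p ^ e with hqdef
  have hq0 : 0 < q := by omega
  obtain ⟨μ, hμ, hμ1⟩ := exists_addMonoidHom_semilinear (iterateFrobenius k p e) hβ
  obtain ⟨ψ, hψ⟩ := exists_addMonoidHom_coeff μ β hq0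
  refine ⟨e, ψ, fun a b => ?_, ?_⟩
  · induction a using MvPolynomial.induction_on' with
    | monomial α u =>
      ext δ
      rw [hψ, monomial_pow, coeff_monomial_mul', coeff_monomial_mul', hψ]
      have hiff : q • α ≤ β + q • δ ↔ α ≤ δ := by
        simp only [Finsupp.le_def, Finsupp.add_apply, Finsupp.smul_apply, smul_eq_mul]
        refine forall_congr' fun i => ⟨fun h => ?_, fun h => ?_⟩
        · by_contra! hlt
          have h1 := hsmall β i hβ
          have h2 : q * (δ i + 1) ≤ q * α i := Nat.mul_le_mul_left q hlt
          rw [mul_add] at h2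
          omega
        · exact (Nat.mul_le_mul_left q h).trans (Nat.le_add_left _ _)
      by_cases hαδ : α ≤ δ
      · rw [if_pos (hiff.2 hαδ), if_pos hαδ]
        have : β + q • δ - q • α = β + q • (δ - α) := by
          ext i
          have := Nat.mul_le_mul_left q (hαδ i)
          simp only [Finsupp.add_apply, Finsupp.smul_apply, smul_eq_mul, Finsupp.tsub_apply,
            Nat.mul_sub]
          omega
        rw [this, ← hμ]
        rfl
      · rw [if_neg (fun h => hαδ (hiff.1 h)), if_neg hαδ, map_zero]
    | add a a' ha ha' => rw [add_pow_char_pow, add_mul, map_add, ha, ha', add_mul]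
  · ext δ
    rw [hψ, coeff_one]
    split_ifs with h
    · rw [← h, smul_zero, add_zero, hμ1]
    · have : coeff (β + q • δ) c = 0 := by
        by_contra hne
        apply h
        ext i
        have h1 := hsmall _ i hne
        simp only [Finsupp.add_apply, Finsupp.smul_apply, smul_eq_mul] at h1
        by_contra h0
        have : q * 1 ≤ q * δ i := Nat.mul_le_mul_left q (Nat.pos_of_ne_zero fun h => h0 (by simp [h]))
        omega
      rw [this, map_zero]

end FrobeniusSplitting

section Retraction

variable {Γ σ k : Type*} [Field k] [CommGroup Γ] [MulSemiringAction Γ (MvPolynomial σ k)]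

/-- An additive retraction onto the invariants that is linear over the invariants. -/
structure IsInvariantRetraction {Γ S : Type*} [CommRing S] [Group Γ] [MulSemiringAction Γ S]
    (π : S →+ S) : Prop where
  smul_apply : ∀ (g : Γ) s, g • π s = π s
  apply_mul : ∀ a s, (∀ g : Γ, g • a = a) → π (a * s) = a * π s
  apply_one : π 1 = 1

theorem exists_isInvariantRetraction (p : ℕ) [Fact p.Prime] [CharP k p] [Finite σ] [Fintype Γ]
    [FaithfulSMul Γ (MvPolynomial σ k)]
    (A : Subalgebra k (MvPolynomial σ k)) (hA : ∀ x, x ∈ A ↔ ∀ g : Γ, g • x = x)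
    {f : σ → MvPolynomial σ k} (hf : AlgebraicIndependent k f)
    (hadj : Algebra.adjoin k (Set.range f) = A) :
    ∃ π : MvPolynomial σ k →+ MvPolynomial σ k, IsInvariantRetraction (Γ := Γ) π := by
  subst hadj
  let E := hf.aevalEquiv
  have htr : ∀ s : MvPolynomial σ k, ∑ g : Γ, g • s ∈ Algebra.adjoin k (Set.range f) :=
    fun s => (hA _).2 fun g => smul_eq_of_sum_smul_eq rfl g
  obtain ⟨x, hx⟩ := exists_sum_smul_ne_zero Γ σ k
  let tr : MvPolynomial σ k →+ Algebra.adjoin k (Set.range f) :=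
    AddMonoidHom.mk' (fun s => ⟨∑ g : Γ, g • (x * s), htr _⟩) fun s t => Subtype.ext (by
      simp [mul_add, smul_add, Finset.sum_add_distrib])
  have htrmul : ∀ a s (ha : ∀ g : Γ, g • a = a), tr (a * s) = ⟨a, (hA a).2 ha⟩ * tr s := by
    intro a s ha
    refine Subtype.ext ?_
    change ∑ g : Γ, g • (x * (a * s)) = a * ∑ g : Γ, g • (x * s)
    rw [Finset.mul_sum]
    refine Finset.sum_congr rfl fun g _ => ?_
    rw [mul_left_comm, smul_mul' g a, ha]
  have hc : E.symm (tr 1) ≠ 0 := by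
    rw [Ne, map_eq_zero_iff _ E.symm.injective, Subtype.ext_iff]
    simpa [tr] using hx
  obtain ⟨e, ψ, hψ, hψ1⟩ := exists_frobenius_splitting p hc
  let π : MvPolynomial σ k →+ MvPolynomial σ k :=
    AddMonoidHom.mk' (fun s => (E (ψ (E.symm (tr (s ^ p ^ e)))) : MvPolynomial σ k)) fun s t => by
      simp only [add_pow_char_pow, map_add, Subalgebra.coe_add]
  have hπ : ∀ s, π s = (E (ψ (E.symm (tr (s ^ p ^ e)))) : MvPolynomial σ k) := fun _ => rfl
  refine ⟨π, fun g s => (hA _).1 (E _).2 g, fun a s ha => ?_, ?_⟩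
  · rw [hπ, hπ, mul_pow, htrmul _ _ (fun g => by rw [smul_pow', ha]), map_mul]
    have : E.symm ⟨a ^ p ^ e, (hA _).2 fun g => by rw [smul_pow', ha]⟩ =
        (E.symm ⟨a, (hA a).2 ha⟩) ^ p ^ e := by
      rw [← map_pow]
      rfl
    rw [this, hψ, map_mul, E.apply_symm_apply]
    rfl
  · rw [hπ, one_pow, hψ1, map_one]
    rfl

end Retraction

section Dualizing

variable {Γ S : Type*} [CommRing S] [CommGroup Γ] [Fintype Γ] [MulSemiringAction Γ S]

theorem IsInvariantRetraction.exists_apply_mul_sum_prod {π : S →+ S}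
    (hπ : IsInvariantRetraction (Γ := Γ) π) (T : Finset Γ) (c' y : Γ → S) (c : S) :
    ∃ x : S, ∀ s, π (c * ∑ h : Γ, (∏ g ∈ T, (c' g - h • y g)) * h • s) = ∑ h : Γ, h • (x * s) := by
  classical
  induction T using Finset.induction_on generalizing c with
  | empty =>
    refine ⟨π c, fun s => ?_⟩
    have hinv : ∀ g : Γ, g • (∑ h : Γ, h • s) = ∑ h : Γ, h • s := by
      intro g
      rw [Finset.smul_sum]
      exact Fintype.sum_equiv (Equiv.mulLeft g) _ _ fun h => by simp [mul_smul]
    simp only [Finset.prod_empty, one_mul, smul_mul', hπ.smul_apply]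
    rw [mul_comm, hπ.apply_mul _ _ hinv, ← Finset.mul_sum, mul_comm]
  | insert a T ha ih =>
    obtain ⟨x₁, h₁⟩ := ih (c * c' a)
    obtain ⟨x₂, h₂⟩ := ih c
    refine ⟨x₁ - x₂ * y a, fun s => ?_⟩
    have : c * ∑ h : Γ, (∏ g ∈ insert a T, (c' g - h • y g)) * h • s =
        c * c' a * ∑ h : Γ, (∏ g ∈ T, (c' g - h • y g)) * h • s -
        c * ∑ h : Γ, (∏ g ∈ T, (c' g - h • y g)) * h • (y a * s) := by
      simp only [Finset.mul_sum, ← Finset.sum_sub_distrib]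
      refine Finset.sum_congr rfl fun h _ => ?_
      rw [Finset.prod_insert ha, smul_mul']
      ring
    rw [this, map_sub, h₁, h₂, ← Finset.sum_sub_distrib]
    refine Finset.sum_congr rfl fun h _ => ?_
    rw [← smul_sub]
    congr 1
    ring

/-- Up to a nonzero invariant factor, a retraction onto the invariants is a multiple of the
transfer. -/
theorem IsInvariantRetraction.exists_sum_smul_mul_eq [IsDomain S] [FaithfulSMul Γ S] {π : S →+ S}
    (hπ : IsInvariantRetraction (Γ := Γ) π) :
    ∃ a x : S, a ≠ 0 ∧ ∀ s, ∑ h : Γ, h • (x * s) = a * π s := by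
  classical
  have hex : ∀ g : Γ, ∃ y : S, g ≠ 1 → g • y - y ≠ 0 := by
    intro g
    by_cases hg : g = 1
    · exact ⟨0, fun h => (h hg).elim⟩
    · by_contra! h
      exact hg (FaithfulSMul.eq_of_smul_eq_smul (α := S) fun s => by
        rw [one_smul]
        exact sub_eq_zero.1 (h s).2)
  choose y hy using hex
  let T : Finset Γ := Finset.univ.erase 1
  let F₀ : S := ∏ g ∈ T, (g • y g - y g)
  have hF₀ : F₀ ≠ 0 := Finset.prod_ne_zero_iff.2 fun g hg => hy g (Finset.ne_of_mem_erase hg)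
  obtain ⟨x, hx⟩ := hπ.exists_apply_mul_sum_prod T (fun g => g • y g) y (∏ g ∈ T, g • F₀)
  refine ⟨∏ g : Γ, g • F₀, x, ?_, fun s => ?_⟩
  · exact Finset.prod_ne_zero_iff.2 fun g _ => (smul_ne_zero_iff_ne g).2 hF₀
  rw [← hx, ← hπ.apply_mul]
  · congr 1
    rw [Finset.sum_eq_single 1]
    · rw [← Finset.mul_prod_erase Finset.univ _ (Finset.mem_univ (1 : Γ))]
      simp only [one_smul, T, F₀]
      ring
    · intro h _ hh
      rw [Finset.prod_eq_zero (Finset.mem_erase.2 ⟨hh, Finset.mem_univ h⟩) (sub_self _), zero_mul]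
    · simp
  · intro g
    simp only [Finset.smul_prod', ← mul_smul]
    exact Fintype.prod_equiv (Equiv.mulLeft g) _ _ fun _ => rfl

end Dualizing

section Descent

variable {Γ σ k : Type*} [Field k] [CommGroup Γ] [Fintype Γ]
  [MulSemiringAction Γ (MvPolynomial σ k)] {p : ℕ} [Fact p.Prime] [CharP k p]

/-- Every nonzero polynomial is the product of a polynomial all of whose prime factors have trivial
inertia group and of an invariant polynomial with invariant prime factors. -/
theorem exists_eq_mul_of_inertiaOf [FaithfulSMul Γ (MvPolynomial σ k)]
    (hlin : IsLinearAction Γ σ k) (hΓ : IsPGroup p Γ) {a : MvPolynomial σ k} (ha : a ≠ 0) :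
    ∃ a₁ a₂ : MvPolynomial σ k, a = a₁ * a₂ ∧ (∀ ℓ, Prime ℓ → ℓ ∣ a₁ → inertiaOf Γ ℓ = ⊥) ∧
      (∀ g : Γ, g • a₂ = a₂) ∧ ∀ ℓ, Prime ℓ → ℓ ∣ a₂ → ∀ g : Γ, g • ℓ = ℓ := by
  have hassoc : ∀ ℓ ℓ' : MvPolynomial σ k, Prime ℓ → Prime ℓ' → ℓ' ∣ ℓ →
      inertiaOf Γ ℓ' = inertiaOf Γ ℓ := by
    intro ℓ ℓ' hℓ hℓ' h
    have := hℓ'.associated_of_dvd hℓ h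
    exact le_antisymm (fun g hg s => this.symm.dvd.trans (hg s)) fun g hg s => h.trans (hg s)
  induction a using UniqueFactorizationMonoid.induction_on_prime with
  | h₁ => exact (ha rfl).elim
  | h₂ u hu =>
    exact ⟨u, 1, (mul_one u).symm, fun ℓ hℓ h => (hℓ.not_isUnit (isUnit_of_dvd_unit h hu)).elim,
      fun g => smul_one g, fun ℓ hℓ h => (hℓ.not_isUnit (isUnit_of_dvd_one h)).elim⟩
  | h₃ a ℓ _ hℓ ih =>
    obtain ⟨a₁, a₂, rfl, h₁, h₂, h₃⟩ := ih (right_ne_zero_of_mul ha)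
    by_cases hI : inertiaOf Γ ℓ = ⊥
    · refine ⟨ℓ * a₁, a₂, by ring, fun ℓ' hℓ' h => ?_, h₂, h₃⟩
      rcases hℓ'.dvd_or_dvd h with h | h
      · rw [hassoc ℓ ℓ' hℓ hℓ' h, hI]
      · exact h₁ ℓ' hℓ' h
    · obtain ⟨h, hh1⟩ := Subgroup.ne_bot_iff_exists_ne_one.1 hI
      have hinv : ∀ ℓ', Prime ℓ' → ℓ' ∣ ℓ → ∀ g : Γ, g • ℓ' = ℓ' := fun ℓ' hℓ' hdvd g =>
        (smul_eq_self_of_mem_inertiaOf hlin hΓ hℓ' (h := h)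
          (by rw [hassoc ℓ ℓ' hℓ hℓ' hdvd]; exact h.2) (fun h1 => hh1 (Subtype.ext h1)) g).1
      refine ⟨a₁, ℓ * a₂, by ring, h₁, fun g => ?_, fun ℓ' hℓ' hdvd => ?_⟩
      · rw [smul_mul', h₂, hinv ℓ hℓ dvd_rfl]
      · rcases hℓ'.dvd_or_dvd hdvd with hdvd | hdvd
        · exact hinv ℓ' hℓ' hdvd
        · exact h₃ ℓ' hℓ' hdvd

/-- A retraction onto the invariants which is a multiple of the transfer up to an invariant factor
with invariant prime factors forces the image of the transfer to be principal. -/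
theorem exists_dvd_sum_smul (hΓ : IsPGroup p Γ)
    {π : MvPolynomial σ k →+ MvPolynomial σ k} (hπ : IsInvariantRetraction (Γ := Γ) π)
    (a x : MvPolynomial σ k) (ha : a ≠ 0) (hax : ∀ s, ∑ h : Γ, h • (x * s) = a * π s)
    (hprime : ∀ ℓ, Prime ℓ → ℓ ∣ a → ∀ g : Γ, g • ℓ = ℓ) :
    ∃ D b : MvPolynomial σ k, ∑ g : Γ, g • b = D ∧ ∀ s, D ∣ ∑ g : Γ, g • s := by
  classical
  induction hn : a.totalDegree using Nat.strong_induction_on generalizing a x with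
  | _ n ih =>
    by_cases hcommon : ∃ ℓ, Prime ℓ ∧ ℓ ∣ a ∧ ℓ ∣ x
    · obtain ⟨ℓ, hℓ, ⟨a', rfl⟩, ⟨x', rfl⟩⟩ := hcommon
      have hinv := hprime ℓ hℓ (dvd_mul_right _ _)
      have ha' := right_ne_zero_of_mul ha
      have hdeg : ℓ.totalDegree ≠ 0 := by
        intro h
        rw [totalDegree_eq_zero_iff_eq_C] at h
        refine hℓ.not_isUnit ?_
        rw [h]
        exact (IsUnit.mk0 _ fun h0 => hℓ.ne_zero (by rw [h, h0, C_0])).map C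
      refine ih a'.totalDegree ?_ a' x' ha' (fun s => mul_left_cancel₀ hℓ.ne_zero ?_)
        (fun ℓ' hℓ' h => hprime ℓ' hℓ' (h.mul_left _)) rfl
      · rw [← hn, totalDegree_mul_of_isDomain hℓ.ne_zero ha']
        omega
      · rw [← mul_assoc, ← hax, Finset.mul_sum]
        refine Finset.sum_congr rfl fun h _ => ?_
        rw [mul_assoc, smul_mul' h ℓ, hinv]
    · refine ⟨a, x, by simpa [hπ.apply_one] using hax 1, fun s => ?_⟩
      refine dvd_of_forall_prime_pow_dvd ha fun ℓ e hℓ he => ?_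
      rcases Nat.eq_zero_or_pos e with rfl | he0
      · simp
      have hℓa : ℓ ∣ a := (dvd_pow_self ℓ he0.ne').trans he
      have hinv := hprime ℓ hℓ hℓa
      have hℓx : ¬ ℓ ∣ x := fun h => hcommon ⟨ℓ, hℓ, hℓa, h⟩
      have hℓN : ¬ ℓ ∣ ∏ g : Γ, g • x := by
        rw [hℓ.dvd_finsetProd_iff]
        rintro ⟨g, -, t, ht⟩
        refine hℓx ⟨g⁻¹ • t, ?_⟩
        rw [← hinv g⁻¹, ← smul_mul', ← ht, inv_smul_smul]
      have hNinv : ∀ g : Γ, g • ∏ g : Γ, g • x = ∏ g : Γ, g • x := by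
        intro g
        simp only [Finset.smul_prod', ← mul_smul]
        exact Fintype.prod_equiv (Equiv.mulLeft g) _ _ fun _ => rfl
      have hI : ∀ s, ℓ ^ e ∣ ∑ h : inertiaOf Γ ℓ, (h : Γ) • (1 * s) := by
        intro s
        have h1 := pow_dvd_sum_inertia hΓ hℓ (D := a) (x := x)
          (fun s => ⟨π s, hax s⟩) he rfl ((∏ g ∈ Finset.univ.erase (1 : Γ), g • x) * s)
        have h2 : x * ((∏ g ∈ Finset.univ.erase (1 : Γ), g • x) * s) = (∏ g : Γ, g • x) * s := by
          rw [← Finset.mul_prod_erase Finset.univ _ (Finset.mem_univ (1 : Γ)), one_smul, mul_assoc]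
        simp only [h2, smul_mul', hNinv, ← Finset.mul_sum] at h1
        rw [one_mul]
        exact hℓ.pow_dvd_of_dvd_mul_left e hℓN h1
      have := dvd_sum_of_dvd_sum_subgroup (K := ⊤) le_top hI (by simp) s
      rw [one_mul] at this
      refine this.trans (dvd_of_eq ?_)
      exact Fintype.sum_equiv Subgroup.topEquiv.toEquiv _ _ fun _ => rfl

/-- If the invariants of an abelian `p`-group are a polynomial ring, then the image of the
transfer is principal. -/
theorem exists_dvd_sum_smul_of_algebraicIndependent [Finite σ]
    [FaithfulSMul Γ (MvPolynomial σ k)] (hlin : IsLinearAction Γ σ k) (hΓ : IsPGroup p Γ)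
    (A : Subalgebra k (MvPolynomial σ k)) (hA : ∀ x, x ∈ A ↔ ∀ g : Γ, g • x = x)
    {f : σ → MvPolynomial σ k} (hf : AlgebraicIndependent k f)
    (hadj : Algebra.adjoin k (Set.range f) = A) :
    ∃ D b : MvPolynomial σ k, ∑ g : Γ, g • b = D ∧ ∀ s, D ∣ ∑ g : Γ, g • s := by
  classical
  obtain ⟨π, hπ⟩ := exists_isInvariantRetraction p A hA hf hadj
  obtain ⟨a, x, ha, hax⟩ := hπ.exists_sum_smul_mul_eq
  obtain ⟨a₁, a₂, rfl, h₁, h₂, h₃⟩ := exists_eq_mul_of_inertiaOf hlin hΓ ha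
  have ha₁ := left_ne_zero_of_mul ha
  have hainv : ∀ g : Γ, g • (a₁ * a₂) = a₁ * a₂ := by
    have := hax 1
    rw [hπ.apply_one, mul_one (a₁ * a₂)] at this
    exact smul_eq_of_sum_smul_eq this
  have ha₁inv : ∀ g : Γ, g • a₁ = a₁ := by
    intro g
    have := hainv g
    rw [smul_mul', h₂] at this
    exact mul_right_cancel₀ (right_ne_zero_of_mul ha) this
  obtain ⟨x', rfl⟩ : a₁ ∣ x := by
    refine dvd_of_forall_prime_pow_dvd ha₁ fun ℓ e hℓ he => ?_
    rcases Nat.eq_zero_or_pos e with rfl | he0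
    · simp
    have := pow_dvd_sum_inertia hΓ hℓ (D := a₁ * a₂) (fun s => ⟨π s, hax s⟩) (he.mul_right _)
      (h₁ ℓ hℓ ((dvd_pow_self ℓ he0.ne').trans he)).symm 1
    rw [Fintype.sum_unique, Subgroup.mem_bot.1 (default : (⊥ : Subgroup Γ)).2] at this
    simpa using this
  refine exists_dvd_sum_smul hΓ hπ a₂ x' (right_ne_zero_of_mul ha)
    (fun s => mul_left_cancel₀ ha₁ ?_) h₃
  rw [← mul_assoc, ← hax, Finset.mul_sum]
  refine Finset.sum_congr rfl fun h _ => ?_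
  rw [mul_assoc, smul_mul' h a₁, ha₁inv]

end Descent

section MatrixGroup

variable {k : Type*} [Field k] {ι : Type*} [Fintype ι] [DecidableEq ι]

theorem galAct_X (M : Matrix.GeneralLinearGroup ι k) (i : ι) : galAct M (X i) =
    ∑ j, (((M⁻¹ : Matrix.GeneralLinearGroup ι k) : Matrix ι ι k) i j) • X j := by
  rw [galAct, aeval_X]

theorem galAct_one : galAct (1 : Matrix.GeneralLinearGroup ι k) = AlgHom.id k _ := by
  ext1 i
  rw [galAct_X, inv_one, Units.val_one, Finset.sum_eq_single i]
  · simp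
  · intro j _ hj
    rw [Matrix.one_apply_ne hj.symm, zero_smul]
  · simp

theorem galAct_mul (M N : Matrix.GeneralLinearGroup ι k) :
    galAct (M * N) = (galAct M).comp (galAct N) := by
  ext1 i
  rw [AlgHom.comp_apply, galAct_X, galAct_X, map_sum, mul_inv_rev, Units.val_mul]
  simp only [map_smul, galAct_X, Matrix.mul_apply, Finset.sum_smul, Finset.smul_sum, smul_smul]
  exact Finset.sum_comm

theorem isHomogeneous_galAct_X (M : Matrix.GeneralLinearGroup ι k) (i : ι) :
    (galAct M (X i)).IsHomogeneous 1 := by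
  rw [galAct_X]
  refine IsHomogeneous.sum _ _ _ fun j _ => ?_
  rw [smul_eq_C_mul]
  exact (isHomogeneous_X _ _).C_mul _

theorem galAct_injective : Function.Injective (galAct (k := k) (ι := ι)) := by
  intro M N h
  refine inv_injective (Units.ext (Matrix.ext fun i j => ?_))
  have h1 : galAct M (X i) = galAct N (X i) := by rw [h]
  rw [galAct_X, galAct_X] at h1
  have h2 := congrArg (coeff (Finsupp.single j 1)) h1
  simpa [coeff_sum, coeff_smul, coeff_X, Finsupp.single_left_inj] using h2

/-- The action of a matrix group on polynomials through `galAct`. -/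
noncomputable abbrev galMulSemiringAction (G : Subgroup (Matrix.GeneralLinearGroup ι k)) :
    MulSemiringAction ↥G (MvPolynomial ι k) where
  smul g f := galAct (g : Matrix.GeneralLinearGroup ι k) f
  one_smul f := DFunLike.congr_fun galAct_one f
  mul_smul g h f := DFunLike.congr_fun (galAct_mul (g : Matrix.GeneralLinearGroup ι k) h) f
  smul_zero _ := map_zero _
  smul_add _ := map_add _
  smul_one _ := map_one _
  smul_mul _ := map_mul _

theorem transfer_mem_invariants (G : Subgroup (Matrix.GeneralLinearGroup ι k)) [Fintype ↥G]
    (s : MvPolynomial ι k) : transfer G s ∈ invariants G := by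
  intro M hM
  rw [transfer, map_sum]
  refine Fintype.sum_equiv (Equiv.mulLeft ⟨M, hM⟩) _ _ fun N => ?_
  exact (DFunLike.congr_fun (galAct_mul M (N : Matrix.GeneralLinearGroup ι k)) s).symm

theorem isPrincipal_transferImage_iff (G : Subgroup (Matrix.GeneralLinearGroup ι k))
    [Fintype ↥G] : (transferImage G).IsPrincipal ↔
      ∃ D b : MvPolynomial ι k, transfer G b = D ∧ ∀ s, D ∣ transfer G s := by
  have hmem : ∀ s, (⟨transfer G s, transfer_mem_invariants G s⟩ : invariants G) ∈
      transferImage G := fun s => ⟨s, rfl⟩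
  constructor
  · rintro ⟨x, hx⟩
    obtain ⟨b, hb⟩ : x ∈ transferImage G := hx ▸ Submodule.mem_span_singleton_self x
    refine ⟨x, b, hb, fun s => ?_⟩
    have h1 := hmem s
    rw [hx] at h1
    obtain ⟨t, ht⟩ := Ideal.mem_span_singleton.1 h1
    exact ⟨t, congrArg Subtype.val ht⟩
  · rintro ⟨D, b, rfl, hD⟩
    refine ⟨⟨transfer G b, transfer_mem_invariants G b⟩, le_antisymm ?_ ?_⟩
    · rintro ⟨_, hy⟩ ⟨s, rfl⟩
      refine Ideal.mem_span_singleton.2 ?_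
      obtain ⟨t, ht⟩ := hD s
      by_cases h0 : transfer G b = 0
      · exact ⟨0, Subtype.ext (by simpa [h0] using ht)⟩
      · refine ⟨⟨t, fun M hM => mul_left_cancel₀ h0 ?_⟩, Subtype.ext ht⟩
        rw [← ht, ← transfer_mem_invariants G s M hM, ht, map_mul,
          transfer_mem_invariants G b M hM]
    · rw [Submodule.span_le, Set.singleton_subset_iff]
      exact hmem b

end MatrixGroup

/-- **a case of the Shank–Wehlau conjecture.** Let `G < GL(V)` be a finite
abelian `p`-group over a field `k` of characteristic `p > 0`. Then the image of the transfer
map `Tr^G : k[V] → k[V]^G` is a principal ideal of `k[V]^G` if and only if the action is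
coregular, i.e. `k[V]^G` is a polynomial ring (generated by `n` algebraically independent
homogeneous invariants). -/
theorem statement16 {k : Type*} [Field k] {n : ℕ} (p : ℕ) [Fact p.Prime] [CharP k p]
    (G : Subgroup (Matrix.GeneralLinearGroup (Fin n) k)) [Fintype ↥G]
    (habelian : ∀ a ∈ G, ∀ b ∈ G, a * b = b * a)
    (hpgroup : IsPGroup p ↥G) :
    (transferImage G).IsPrincipal ↔
      ∃ f : Fin n → MvPolynomial (Fin n) k,
        (∀ i, f i ∈ invariants G) ∧
        (∀ i, ∃ d, 0 < d ∧ (f i).IsHomogeneous d) ∧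
        AlgebraicIndependent k f ∧
        Algebra.adjoin k (Set.range f) = invariants G := by
  let : CommGroup ↥G :=
    { (inferInstance : Group ↥G) with
      mul_comm := fun a b => Subtype.ext (habelian a a.2 b b.2) }
  let := galMulSemiringAction G
  have hsmul : ∀ (g : ↥G) (s : MvPolynomial (Fin n) k),
      g • s = galAct (g : Matrix.GeneralLinearGroup (Fin n) k) s := fun _ _ => rfl
  have hlin : IsLinearAction ↥G (Fin n) k :=
    ⟨fun g c => (galAct _).commutes c, fun g i => isHomogeneous_galAct_X _ i⟩
  have : FaithfulSMul ↥G (MvPolynomial (Fin n) k) :=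
    ⟨fun {g h} hgh => Subtype.ext (galAct_injective (AlgHom.ext hgh))⟩
  have htransfer : ∀ s, transfer G s = ∑ g : ↥G, g • s := fun _ => rfl
  have hinv : ∀ x, x ∈ invariants G ↔ ∀ g : ↥G, g • x = x :=
    fun x => ⟨fun h g => h g g.2, fun h M hM => h ⟨M, hM⟩⟩
  rw [isPrincipal_transferImage_iff]
  simp only [htransfer]
  constructor
  · rintro ⟨D, b, hb, hD⟩
    obtain ⟨f, hf, hind, hadj⟩ := exists_polynomial_generators MonomialOrder.lex hlin hpgroup hb hD
    refine ⟨f, fun i => (hinv _).2 (hf i).1, fun i => (hf i).2, hind, le_antisymm ?_ ?_⟩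
    · rw [Algebra.adjoin_le_iff]
      rintro _ ⟨i, rfl⟩
      exact (hinv _).2 (hf i).1
    · exact fun x hx => hadj x ((hinv x).1 hx)
  · rintro ⟨f, -, -, hind, hadj⟩
    exact exists_dvd_sum_smul_of_algebraicIndependent hlin hpgroup _ hinv hind hadj
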